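/- arXiv:2405.17930 — 4 statements merged into one kernel-verified Lean document; each statement's English description precedes it below -/
import Mathlib

section
/- Let K be an algebraically closed field of characteristic zero, let d ≥ 1, and let A = K⟨v1,…,vd⟩ be the free associative K-algebra. If ⟪-,-⟫ : A⊗A → A⊗A is a mixed double Poisson algebra structure on A of weight λ = (λ1,…,λd) ∈ K^d, then ⟪-,-⟫ is a modified double Poisson bracket on A; that is, for all a,b,c ∈ A one has {a,b} + {b,a} ∈ [A,A] and {a,{b,c}} − {b,{a,c}} − {{a,b},c} = 0. -/
open TensorProduct

noncomputable section

variable (K : Type*) [Field K]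
variable (A : Type*) [Ring A] [Algebra K A]

/-- Leibniz rules for a double-bracket-type operation. -/
def LeibnizRules (D : A ⊗[K] A →ₗ[K] A ⊗[K] A) : Prop :=
  (∀ a b c : A,
      D (a ⊗ₜ[K] (b * c)) =
        (b ⊗ₜ[K] (1 : A)) * D (a ⊗ₜ[K] c) + D (a ⊗ₜ[K] b) * ((1 : A) ⊗ₜ[K] c))
  ∧ (∀ a b c : A,
      D ((a * b) ⊗ₜ[K] c) =
        ((1 : A) ⊗ₜ[K] a) * D (b ⊗ₜ[K] c) + D (a ⊗ₜ[K] c) * (b ⊗ₜ[K] (1 : A)))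

/-- The associated bracket `{a,b} = m(⟪a,b⟫)`. -/
def br (D : A ⊗[K] A →ₗ[K] A ⊗[K] A) (a b : A) : A :=
  LinearMap.mul' K A (D (a ⊗ₜ[K] b))

/-- The K-span of commutators `[A,A]`. -/
def commutatorSpan : Submodule K A :=
  Submodule.span K {x : A | ∃ a b : A, x = a * b - b * a}

/-- The flip on `A ⊗ A`. -/
def flipT : A ⊗[K] A →ₗ[K] A ⊗[K] A := (TensorProduct.comm K A A).toLinearMap

/-- Swap of the last two tensor factors of `(A ⊗ A) ⊗ A`. -/
def swap23 : ((A ⊗[K] A) ⊗[K] A) →ₗ[K] ((A ⊗[K] A) ⊗[K] A) :=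
  (TensorProduct.assoc K A A A).symm.toLinearMap ∘ₗ
    (LinearMap.lTensor A (TensorProduct.comm K A A).toLinearMap) ∘ₗ
    (TensorProduct.assoc K A A A).toLinearMap

/-- `⟪a, -⟫_L` on double tensors: `b ⊗ c ↦ ⟪a,b⟫ ⊗ c`. -/
def dL (D : A ⊗[K] A →ₗ[K] A ⊗[K] A) (a : A) :
    A ⊗[K] A →ₗ[K] (A ⊗[K] A) ⊗[K] A :=
  LinearMap.rTensor A (D ∘ₗ TensorProduct.mk K A A a)

/-- `⟪a, -⟫_R` on double tensors: `b ⊗ c ↦ b ⊗ ⟪a,c⟫`. -/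
def dR (D : A ⊗[K] A →ₗ[K] A ⊗[K] A) (a : A) :
    A ⊗[K] A →ₗ[K] (A ⊗[K] A) ⊗[K] A :=
  (TensorProduct.assoc K A A A).symm.toLinearMap ∘ₗ
    LinearMap.lTensor A (D ∘ₗ TensorProduct.mk K A A a)

/-- `⟪-, c⟫_L` on double tensors: `b ⊗ b' ↦ ⟪b,c⟫' ⊗ b' ⊗ ⟪b,c⟫''`. -/
def dLfst (D : A ⊗[K] A →ₗ[K] A ⊗[K] A) (c : A) :
    A ⊗[K] A →ₗ[K] (A ⊗[K] A) ⊗[K] A :=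
  swap23 K A ∘ₗ LinearMap.rTensor A (D ∘ₗ (TensorProduct.mk K A A).flip c)

/-- The double Jacobiator. -/
def DJac (D : A ⊗[K] A →ₗ[K] A ⊗[K] A) (a b c : A) : (A ⊗[K] A) ⊗[K] A :=
  dL K A D a (D (b ⊗ₜ[K] c)) - dR K A D b (D (a ⊗ₜ[K] c)) - dLfst K A D c (D (a ⊗ₜ[K] b))

/-- `c ⊗₁ (-)` : `w' ⊗ w'' ↦ w' ⊗ c ⊗ w''`. -/
def otimes1 (c : A) : A ⊗[K] A →ₗ[K] (A ⊗[K] A) ⊗[K] A :=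
  LinearMap.rTensor A ((TensorProduct.mk K A A).flip c)

variable {ι : Type*}

/-- Mixed double algebra structure of weight `lam` with respect to the generators `v`. -/
def IsMixedDouble (v : ι → A) (lam : ι → K) (D : A ⊗[K] A →ₗ[K] A ⊗[K] A) : Prop :=
  LeibnizRules K A D ∧
  ∀ i j : ι,
    D (v i ⊗ₜ[K] v j) + flipT K A (D (v j ⊗ₜ[K] v i)) =
      ((lam i + lam j) / 2) • (v i ⊗ₜ[K] v j - v j ⊗ₜ[K] v i) +
      ((lam i - lam j) / 2) • ((1 : A) ⊗ₜ[K] (v i * v j) - (v j * v i) ⊗ₜ[K] (1 : A))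

/-- Mixed double Poisson algebra structure of weight `lam` w.r.t. the generators `v`. -/
def IsMixedDoublePoisson (v : ι → A) (lam : ι → K) (D : A ⊗[K] A →ₗ[K] A ⊗[K] A) : Prop :=
  IsMixedDouble K A v lam D ∧
  ∀ i j k : ι,
    DJac K A D (v i) (v j) (v k) =
      (-((lam i + lam j) / 2)) • otimes1 K A (v j) (D (v i ⊗ₜ[K] v k)) +
      ((lam i - lam j) / 2) •
        otimes1 K A (1 : A) (((1 : A) ⊗ₜ[K] v j) * D (v i ⊗ₜ[K] v k))

/-- Modified double Poisson bracket. -/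
def IsModifiedDoublePoisson (D : A ⊗[K] A →ₗ[K] A ⊗[K] A) : Prop :=
  LeibnizRules K A D ∧
  (∀ a b : A, br K A D a b + br K A D b a ∈ commutatorSpan K A) ∧
  (∀ a b c : A,
    br K A D a (br K A D b c) - br K A D b (br K A D a c) - br K A D (br K A D a b) c = 0)

end

noncomputable section aux

variable {K : Type*} [Field K] {A : Type*} [Ring A] [Algebra K A]

/-- `w, u ↦ w' ⊗ u' ⊗ u'' w''`. -/
def nIns (w u : A ⊗[K] A) : (A ⊗[K] A) ⊗[K] A :=
  (TensorProduct.assoc K A A A).symm ((1 : A) ⊗ₜ[K] u) * otimes1 K A (1 : A) w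

/-- `F, E ↦ F'E' ⊗ E'' ⊗ F''`. -/
def mIns (F E : A ⊗[K] A) : (A ⊗[K] A) ⊗[K] A :=
  otimes1 K A (1 : A) F * (E ⊗ₜ[K] (1 : A))

/-- multiply the first two factors -/
def mFst : (A ⊗[K] A) ⊗[K] A →ₗ[K] A ⊗[K] A :=
  LinearMap.rTensor A (LinearMap.mul' K A)

/-- multiply the last two factors -/
def mSnd : (A ⊗[K] A) ⊗[K] A →ₗ[K] A ⊗[K] A :=
  LinearMap.lTensor A (LinearMap.mul' K A) ∘ₗ (TensorProduct.assoc K A A A).toLinearMap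

/-- `x ⊗ y ↦ (1 ⊗ y) ⟪x,c⟫` -/
def phiM (D : A ⊗[K] A →ₗ[K] A ⊗[K] A) (c : A) : A ⊗[K] A →ₗ[K] A ⊗[K] A :=
  mSnd ∘ₗ dLfst K A D c

lemma nIns_tmul (a b c d : A) :
    nIns (a ⊗ₜ[K] b) (c ⊗ₜ[K] d) = (a ⊗ₜ[K] c) ⊗ₜ[K] (d * b) := by
  simp [nIns, otimes1]

lemma mIns_tmul (a b c d : A) :
    mIns (a ⊗ₜ[K] b) (c ⊗ₜ[K] d) = ((a * c) ⊗ₜ[K] d) ⊗ₜ[K] b := by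
  simp [mIns, otimes1]

lemma mFst_tmul (a b c : A) : mFst ((a ⊗ₜ[K] b) ⊗ₜ[K] c) = (a * b) ⊗ₜ[K] c := by
  simp [mFst]

lemma mSnd_tmul (a b c : A) : mSnd ((a ⊗ₜ[K] b) ⊗ₜ[K] c) = a ⊗ₜ[K] (b * c) := by
  simp [mSnd]

lemma swap23_tmul (a b c : A) :
    swap23 K A ((a ⊗ₜ[K] b) ⊗ₜ[K] c) = (a ⊗ₜ[K] c) ⊗ₜ[K] b := by
  simp [swap23]

lemma flipT_tmul (a b : A) : flipT K A (a ⊗ₜ[K] b) = b ⊗ₜ[K] a := by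
  simp [flipT]

lemma nIns_add_left (w w' u : A ⊗[K] A) : nIns (w + w') u = nIns w u + nIns w' u := by
  simp [nIns, mul_add]
lemma nIns_add_right (w u u' : A ⊗[K] A) : nIns w (u + u') = nIns w u + nIns w u' := by
  simp [nIns, add_mul, TensorProduct.tmul_add]
lemma nIns_sub_right (w u u' : A ⊗[K] A) : nIns w (u - u') = nIns w u - nIns w u' := by
  simp [nIns, sub_mul, TensorProduct.tmul_sub]
lemma nIns_smul_right (w u : A ⊗[K] A) (r : K) : nIns w (r • u) = r • nIns w u := by
  simp [nIns, smul_mul_assoc]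
lemma nIns_zero_left (u : A ⊗[K] A) : nIns 0 u = 0 := by simp [nIns]
lemma nIns_zero_right (u : A ⊗[K] A) : nIns u 0 = 0 := by simp [nIns]
lemma mIns_add_left (w w' u : A ⊗[K] A) : mIns (w + w') u = mIns w u + mIns w' u := by
  simp [mIns, add_mul]
lemma mIns_add_right (w u u' : A ⊗[K] A) : mIns w (u + u') = mIns w u + mIns w u' := by
  simp [mIns, mul_add, TensorProduct.add_tmul]
lemma mIns_zero_left (u : A ⊗[K] A) : mIns 0 u = 0 := by simp [mIns]
lemma mIns_zero_right (u : A ⊗[K] A) : mIns u 0 = 0 := by simp [mIns]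

lemma dL_tmul (D : A ⊗[K] A →ₗ[K] A ⊗[K] A) (a x y : A) :
    dL K A D a (x ⊗ₜ[K] y) = D (a ⊗ₜ[K] x) ⊗ₜ[K] y := by
  simp [dL]
lemma dR_tmul (D : A ⊗[K] A →ₗ[K] A ⊗[K] A) (a x y : A) :
    dR K A D a (x ⊗ₜ[K] y) = (TensorProduct.assoc K A A A).symm (x ⊗ₜ[K] D (a ⊗ₜ[K] y)) := by
  simp [dR]
lemma dLfst_tmul (D : A ⊗[K] A →ₗ[K] A ⊗[K] A) (a x y : A) :
    dLfst K A D a (x ⊗ₜ[K] y) = swap23 K A (D (x ⊗ₜ[K] a) ⊗ₜ[K] y) := by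
  simp [dLfst]

/- module rules for `nIns` -/
lemma nIns_r3 (w u : A ⊗[K] A) (b : A) :
    nIns w (((1 : A) ⊗ₜ[K] b) * u) = ((1 : A ⊗[K] A) ⊗ₜ[K] b) * nIns w u := by
  induction w with
  | zero => simp [nIns_zero_left]
  | add x y hx hy => simp only [nIns_add_left, hx, hy, mul_add]
  | tmul x y =>
    induction u with
    | zero => simp [nIns_zero_right]
    | add x y hx hy => simp only [nIns_add_right, hx, hy, mul_add]
    | tmul z t => simp [nIns_tmul, mul_assoc]
lemma nIns_r2 (w u : A ⊗[K] A) (b : A) :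
    nIns w (u * (b ⊗ₜ[K] (1 : A))) = nIns w u * (((1 : A) ⊗ₜ[K] b) ⊗ₜ[K] (1 : A)) := by
  induction w with
  | zero => simp [nIns_zero_left]
  | add x y hx hy => simp only [nIns_add_left, hx, hy, add_mul]
  | tmul x y =>
    induction u with
    | zero => simp [nIns_zero_right]
    | add x y hx hy => simp only [nIns_add_right, hx, hy, add_mul]
    | tmul z t => simp [nIns_tmul]
lemma nIns_l2 (w u : A ⊗[K] A) (b : A) :
    nIns w ((b ⊗ₜ[K] (1 : A)) * u) = (((1 : A) ⊗ₜ[K] b) ⊗ₜ[K] (1 : A)) * nIns w u := by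
  induction w with
  | zero => simp [nIns_zero_left]
  | add x y hx hy => simp only [nIns_add_left, hx, hy, mul_add]
  | tmul x y =>
    induction u with
    | zero => simp [nIns_zero_right]
    | add x y hx hy => simp only [nIns_add_right, hx, hy, mul_add]
    | tmul z t => simp [nIns_tmul]
lemma nIns_w1 (w u : A ⊗[K] A) (b : A) :
    nIns (w * (b ⊗ₜ[K] (1 : A))) u = nIns w u * ((b ⊗ₜ[K] (1 : A)) ⊗ₜ[K] (1 : A)) := by
  induction w with
  | zero => simp [nIns_zero_left]
  | add x y hx hy => simp only [nIns_add_left, hx, hy, add_mul]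
  | tmul x y =>
    induction u with
    | zero => simp [nIns_zero_right]
    | add x y hx hy => simp only [nIns_add_right, hx, hy, add_mul]
    | tmul z t => simp [nIns_tmul]
lemma nIns_w2 (w u : A ⊗[K] A) (b : A) :
    nIns (((1 : A) ⊗ₜ[K] b) * w) u = nIns w (u * ((1 : A) ⊗ₜ[K] b)) := by
  induction w with
  | zero => simp [nIns_zero_left]
  | add x y hx hy => simp only [nIns_add_left, hx, hy, mul_add]
  | tmul x y =>
    induction u with
    | zero => simp [nIns_zero_right]
    | add x y hx hy => simp only [nIns_add_right, hx, hy, add_mul]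
    | tmul z t => simp [nIns_tmul, mul_assoc]
lemma otimes1_eq (b : A) (w : A ⊗[K] A) :
    otimes1 K A b w = nIns w (b ⊗ₜ[K] (1 : A)) := by
  induction w with
  | zero => simp [nIns_zero_left]
  | add x y hx hy => simp only [nIns_add_left, hx, hy, map_add]
  | tmul x y => simp [otimes1, nIns_tmul]
lemma otimes1_one_eq (b : A) (w : A ⊗[K] A) :
    otimes1 K A 1 (((1 : A) ⊗ₜ[K] b) * w) = nIns w ((1 : A) ⊗ₜ[K] b) := by
  induction w with
  | zero => simp [nIns_zero_left]
  | add x y hx hy => simp only [nIns_add_left, hx, hy, mul_add, map_add]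
  | tmul x y => simp [otimes1, nIns_tmul]

/- mFst, mSnd on things -/
lemma mFst_l3 (u : (A ⊗[K] A) ⊗[K] A) (b : A) :
    mFst (((1 : A ⊗[K] A) ⊗ₜ[K] b) * u) = ((1 : A) ⊗ₜ[K] b) * mFst u := by
  induction u with
  | zero => simp
  | add x y hx hy => simp only [mul_add, map_add, hx, hy]
  | tmul x y =>
    induction x with
    | zero => simp
    | add x z hx hy => simp only [mul_add, map_add, hx, hy, TensorProduct.add_tmul]
    | tmul z t => simp [mFst_tmul]
lemma mFst_r2 (u : (A ⊗[K] A) ⊗[K] A) (b : A) :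
    mFst (u * (((1 : A) ⊗ₜ[K] b) ⊗ₜ[K] (1 : A))) = mFst u * (b ⊗ₜ[K] (1 : A)) := by
  induction u with
  | zero => simp
  | add x y hx hy => simp only [add_mul, map_add, hx, hy]
  | tmul x y =>
    induction x with
    | zero => simp
    | add x z hx hy => simp only [add_mul, map_add, hx, hy, TensorProduct.add_tmul]
    | tmul z t => simp [mFst_tmul, mul_assoc]
lemma mFst_nIns_left (w : A ⊗[K] A) (b : A) :
    mFst (nIns w (b ⊗ₜ[K] (1 : A))) = w * (b ⊗ₜ[K] (1 : A)) := by
  induction w with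
  | zero => simp [nIns_zero_left]
  | add x y hx hy => simp only [nIns_add_left, hx, hy, add_mul, map_add]
  | tmul x y => simp [nIns_tmul, mFst_tmul]
lemma mFst_nIns_right (w : A ⊗[K] A) (b : A) :
    mFst (nIns w ((1 : A) ⊗ₜ[K] b)) = ((1 : A) ⊗ₜ[K] b) * w := by
  induction w with
  | zero => simp [nIns_zero_left]
  | add x y hx hy => simp only [nIns_add_left, hx, hy, mul_add, map_add]
  | tmul x y => simp [nIns_tmul, mFst_tmul]
lemma mSnd_nIns (w u : A ⊗[K] A) :
    mSnd (nIns w u) = ((1 : A) ⊗ₜ[K] LinearMap.mul' K A u) * w := by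
  induction w with
  | zero => simp [nIns_zero_left]
  | add x y hx hy => simp only [nIns_add_left, hx, hy, mul_add, map_add]
  | tmul x y =>
    induction u with
    | zero => simp [nIns_zero_right]
    | add x y hx hy =>
      simp only [nIns_add_right, hx, hy, map_add, TensorProduct.tmul_add, add_mul]
    | tmul z t => simp [nIns_tmul, mSnd_tmul, mul_assoc]

lemma flipT_mul (u w : A ⊗[K] A) :
    flipT K A (u * w) = flipT K A u * flipT K A w := by
  exact map_mul (Algebra.TensorProduct.comm K A A) u w

lemma swap23_mul_l3 (u : (A ⊗[K] A) ⊗[K] A) (x y z : A) :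
    swap23 K A (((x ⊗ₜ[K] y) ⊗ₜ[K] z) * u) = ((x ⊗ₜ[K] z) ⊗ₜ[K] y) * swap23 K A u := by
  induction u with
  | zero => simp
  | add x y hx hy => simp only [mul_add, map_add, hx, hy]
  | tmul p q =>
    induction p with
    | zero => simp
    | add p z hx hy => simp only [mul_add, map_add, hx, hy, TensorProduct.add_tmul]
    | tmul r t => simp [swap23_tmul]
lemma swap23_mul_r3 (u : (A ⊗[K] A) ⊗[K] A) (x y z : A) :
    swap23 K A (u * ((x ⊗ₜ[K] y) ⊗ₜ[K] z)) = swap23 K A u * ((x ⊗ₜ[K] z) ⊗ₜ[K] y) := by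
  induction u with
  | zero => simp
  | add x y hx hy => simp only [add_mul, map_add, hx, hy]
  | tmul p q =>
    induction p with
    | zero => simp
    | add p z hx hy => simp only [add_mul, map_add, hx, hy, TensorProduct.add_tmul]
    | tmul r t => simp [swap23_tmul]
lemma assocs_mul_l (u : A ⊗[K] (A ⊗[K] A)) (x y z : A) :
    (TensorProduct.assoc K A A A).symm ((x ⊗ₜ[K] (y ⊗ₜ[K] z)) * u)
      = ((x ⊗ₜ[K] y) ⊗ₜ[K] z) * (TensorProduct.assoc K A A A).symm u := by
  induction u with
  | zero => simp
  | add x y hx hy => simp only [mul_add, map_add, hx, hy]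
  | tmul q p =>
    induction p with
    | zero => simp
    | add p z hx hy => simp only [mul_add, map_add, hx, hy, TensorProduct.tmul_add]
    | tmul r t => simp
lemma assocs_mul_r (u : A ⊗[K] (A ⊗[K] A)) (x y z : A) :
    (TensorProduct.assoc K A A A).symm (u * (x ⊗ₜ[K] (y ⊗ₜ[K] z)))
      = (TensorProduct.assoc K A A A).symm u * ((x ⊗ₜ[K] y) ⊗ₜ[K] z) := by
  induction u with
  | zero => simp
  | add x y hx hy => simp only [add_mul, map_add, hx, hy]
  | tmul q p =>
    induction p with
    | zero => simp
    | add p z hx hy => simp only [add_mul, map_add, hx, hy, TensorProduct.tmul_add]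
    | tmul r t => simp

variable {D : A ⊗[K] A →ₗ[K] A ⊗[K] A}

lemma LeibnizRules.one_left (h : LeibnizRules K A D) (c : A) : D ((1 : A) ⊗ₜ[K] c) = 0 := by
  have := h.2 1 1 c
  simpa [← Algebra.TensorProduct.one_def] using this
lemma LeibnizRules.one_right (h : LeibnizRules K A D) (c : A) : D (c ⊗ₜ[K] (1 : A)) = 0 := by
  have := h.1 c 1 1
  simpa [← Algebra.TensorProduct.one_def] using this

lemma dL_l3 (a b : A) (F : A ⊗[K] A) :
    dL K A D a (((1 : A) ⊗ₜ[K] b) * F) = ((1 : A ⊗[K] A) ⊗ₜ[K] b) * dL K A D a F := by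
  induction F with
  | zero => simp
  | add x y hx hy => simp only [mul_add, map_add, hx, hy]
  | tmul x y => simp [dL_tmul]

lemma dL_r1 (h : LeibnizRules K A D) (a b : A) (F : A ⊗[K] A) :
    dL K A D a (F * (b ⊗ₜ[K] (1 : A))) =
      dL K A D a F * (((1 : A) ⊗ₜ[K] b) ⊗ₜ[K] (1 : A)) + mIns F (D (a ⊗ₜ[K] b)) := by
  induction F with
  | zero => simp [mIns_zero_left]
  | add x y hx hy => simp only [add_mul, map_add, hx, hy, mIns_add_left]; abel
  | tmul x y =>
    simp [dL_tmul, h.1, mIns, otimes1, TensorProduct.add_tmul, add_comm]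

lemma dR_mul (h : LeibnizRules K A D) (b b' : A) (G : A ⊗[K] A) :
    dR K A D (b * b') G = ((1 : A ⊗[K] A) ⊗ₜ[K] b) * dR K A D b' G +
      dR K A D b G * (((1 : A) ⊗ₜ[K] b') ⊗ₜ[K] (1 : A)) := by
  induction G with
  | zero => simp
  | add x y hx hy => simp only [add_mul, mul_add, map_add, hx, hy]; abel
  | tmul x y =>
    rw [dR_tmul, dR_tmul, dR_tmul, h.2, Algebra.TensorProduct.one_def, ← assocs_mul_l,
      ← assocs_mul_r, ← map_add]
    simp [TensorProduct.tmul_add]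

lemma dLfst_l1 (h : LeibnizRules K A D) (c b : A) (E : A ⊗[K] A) :
    dLfst K A D c ((b ⊗ₜ[K] (1 : A)) * E) =
      ((1 : A ⊗[K] A) ⊗ₜ[K] b) * dLfst K A D c E + mIns (D (b ⊗ₜ[K] c)) E := by
  induction E with
  | zero => simp [mIns_zero_right]
  | add x y hx hy => simp only [mul_add, map_add, hx, hy, mIns_add_right]; abel
  | tmul x y =>
    have key : mIns (D (b ⊗ₜ[K] c)) (x ⊗ₜ[K] y) =
        swap23 K A ((D (b ⊗ₜ[K] c) * (x ⊗ₜ[K] (1 : A))) ⊗ₜ[K] y) := by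
      generalize D (b ⊗ₜ[K] c) = w
      induction w with
      | zero => simp [mIns_zero_left]
      | add x y hx hy => simp only [add_mul, map_add, hx, hy, mIns_add_left, TensorProduct.add_tmul]
      | tmul z t => simp [mIns_tmul, swap23_tmul]
    rw [key, dLfst_tmul, Algebra.TensorProduct.one_def, ← swap23_mul_l3, ← map_add]
    simp [dLfst_tmul, h.2, TensorProduct.add_tmul]

lemma dLfst_r2 (c b : A) (E : A ⊗[K] A) :
    dLfst K A D c (E * ((1 : A) ⊗ₜ[K] b)) =
      dLfst K A D c E * (((1 : A) ⊗ₜ[K] b) ⊗ₜ[K] (1 : A)) := by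
  induction E with
  | zero => simp
  | add x y hx hy => simp only [add_mul, map_add, hx, hy]
  | tmul x y =>
    rw [dLfst_tmul, ← swap23_mul_r3]
    simp [dLfst_tmul, ← Algebra.TensorProduct.one_def]

lemma DJac_mul_mid (h : LeibnizRules K A D) (a b b' c : A) :
    DJac K A D a (b * b') c = ((1 : A ⊗[K] A) ⊗ₜ[K] b) * DJac K A D a b' c +
      DJac K A D a b c * (((1 : A) ⊗ₜ[K] b') ⊗ₜ[K] (1 : A)) := by
  simp only [DJac, h.2 b b' c, h.1 a b b', map_add, dL_l3, dL_r1 h, dR_mul h, dLfst_l1 h,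
    dLfst_r2, mul_sub, sub_mul]
  abel

lemma dL_mul (h : LeibnizRules K A D) (a a' : A) (F : A ⊗[K] A) :
    dL K A D (a * a') F = (((1 : A) ⊗ₜ[K] a) ⊗ₜ[K] (1 : A)) * dL K A D a' F +
      dL K A D a F * ((a' ⊗ₜ[K] (1 : A)) ⊗ₜ[K] (1 : A)) := by
  induction F with
  | zero => simp
  | add x y hx hy => simp only [add_mul, mul_add, map_add, hx, hy]; abel
  | tmul x y => simp [dL_tmul, h.2, TensorProduct.add_tmul]

lemma dR_l2 (h : LeibnizRules K A D) (b a : A) (G : A ⊗[K] A) :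
    dR K A D b (((1 : A) ⊗ₜ[K] a) * G) =
      (((1 : A) ⊗ₜ[K] a) ⊗ₜ[K] (1 : A)) * dR K A D b G + nIns G (D (b ⊗ₜ[K] a)) := by
  induction G with
  | zero => simp [nIns_zero_left]
  | add x y hx hy => simp only [mul_add, map_add, hx, hy, nIns_add_left]; abel
  | tmul x y =>
    have key : nIns (x ⊗ₜ[K] y) (D (b ⊗ₜ[K] a)) =
        (TensorProduct.assoc K A A A).symm (x ⊗ₜ[K] (D (b ⊗ₜ[K] a) * ((1 : A) ⊗ₜ[K] y))) := by
      generalize D (b ⊗ₜ[K] a) = w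
      induction w with
      | zero => simp [nIns_zero_right]
      | add x y hx hy => simp only [add_mul, map_add, hx, hy, nIns_add_right, TensorProduct.tmul_add]
      | tmul z t => simp [nIns_tmul]
    rw [key, dR_tmul, ← assocs_mul_l, ← map_add]
    simp [dR_tmul, h.1, TensorProduct.tmul_add]

lemma dR_r1 (b a : A) (G : A ⊗[K] A) :
    dR K A D b (G * (a ⊗ₜ[K] (1 : A))) =
      dR K A D b G * ((a ⊗ₜ[K] (1 : A)) ⊗ₜ[K] (1 : A)) := by
  induction G with
  | zero => simp
  | add x y hx hy => simp only [add_mul, map_add, hx, hy]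
  | tmul x y =>
    rw [dR_tmul, ← assocs_mul_r]
    simp [dR_tmul, ← Algebra.TensorProduct.one_def]

lemma dLfst_l2 (c a : A) (E : A ⊗[K] A) :
    dLfst K A D c (((1 : A) ⊗ₜ[K] a) * E) =
      (((1 : A) ⊗ₜ[K] a) ⊗ₜ[K] (1 : A)) * dLfst K A D c E := by
  induction E with
  | zero => simp
  | add x y hx hy => simp only [mul_add, map_add, hx, hy]
  | tmul x y =>
    rw [dLfst_tmul, ← swap23_mul_l3]
    simp [dLfst_tmul, ← Algebra.TensorProduct.one_def]

lemma dLfst_r1 (h : LeibnizRules K A D) (c a : A) (E : A ⊗[K] A) :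
    dLfst K A D c (E * (a ⊗ₜ[K] (1 : A))) =
      dLfst K A D c E * ((a ⊗ₜ[K] (1 : A)) ⊗ₜ[K] (1 : A)) +
        nIns (D (a ⊗ₜ[K] c)) (flipT K A E) := by
  induction E with
  | zero => simp [nIns_zero_right]
  | add x y hx hy => simp only [add_mul, map_add, hx, hy, nIns_add_right]; abel
  | tmul x y =>
    have key : nIns (D (a ⊗ₜ[K] c)) (flipT K A (x ⊗ₜ[K] y)) =
        swap23 K A ((((1 : A) ⊗ₜ[K] x) * D (a ⊗ₜ[K] c)) ⊗ₜ[K] y) := by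
      generalize D (a ⊗ₜ[K] c) = w
      induction w with
      | zero => simp [nIns_zero_left]
      | add x y hx hy => simp only [mul_add, map_add, hx, hy, nIns_add_left, TensorProduct.add_tmul]
      | tmul z t => simp [nIns_tmul, swap23_tmul, flipT_tmul]
    rw [key, dLfst_tmul, ← swap23_mul_r3, ← map_add]
    simp [dLfst_tmul, h.2, TensorProduct.add_tmul, add_comm]

lemma DJac_mul_left (h : LeibnizRules K A D) (a a' b c : A) :
    DJac K A D (a * a') b c = (((1 : A) ⊗ₜ[K] a) ⊗ₜ[K] (1 : A)) * DJac K A D a' b c +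
      DJac K A D a b c * ((a' ⊗ₜ[K] (1 : A)) ⊗ₜ[K] (1 : A)) -
      nIns (D (a' ⊗ₜ[K] c)) (D (b ⊗ₜ[K] a) + flipT K A (D (a ⊗ₜ[K] b))) := by
  simp only [DJac, h.2, map_add, dL_mul h, dR_l2 h, dR_r1, dLfst_l2,
    dLfst_r1 h, mul_sub, sub_mul, nIns_add_right]
  abel

/-- Lie derivative of the double bracket along `{a,-}`. -/
def hLift (D : A ⊗[K] A →ₗ[K] A ⊗[K] A) (a : A) : A ⊗[K] A →ₗ[K] A ⊗[K] A :=
  mFst ∘ₗ dL K A D a + mSnd ∘ₗ dR K A D a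

def tLie (D : A ⊗[K] A →ₗ[K] A ⊗[K] A) (a b c : A) : A ⊗[K] A :=
  hLift D a (D (b ⊗ₜ[K] c)) - D (br K A D a b ⊗ₜ[K] c) - D (b ⊗ₜ[K] br K A D a c)

lemma mSnd_assocs (x : A) (w : A ⊗[K] A) :
    mSnd ((TensorProduct.assoc K A A A).symm (x ⊗ₜ[K] w)) = x ⊗ₜ[K] LinearMap.mul' K A w := by
  simp [mSnd]

lemma mFst_assocs (x : A) (w : A ⊗[K] A) :
    mFst ((TensorProduct.assoc K A A A).symm (x ⊗ₜ[K] w)) = (x ⊗ₜ[K] (1 : A)) * w := by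
  induction w with
  | zero => simp
  | add x y hx hy => simp only [mul_add, map_add, hx, hy, TensorProduct.tmul_add]
  | tmul z t => simp [mFst_tmul]

lemma mSnd_tmul' (w : A ⊗[K] A) (y : A) :
    mSnd (w ⊗ₜ[K] y) = w * ((1 : A) ⊗ₜ[K] y) := by
  induction w with
  | zero => simp
  | add x y hx hy => simp only [add_mul, map_add, hx, hy, TensorProduct.add_tmul]
  | tmul z t => simp [mSnd_tmul]

lemma mFst_tmul' (w : A ⊗[K] A) (y : A) :
    mFst (w ⊗ₜ[K] y) = LinearMap.mul' K A w ⊗ₜ[K] y := by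
  simp [mFst]

lemma mFst_swap (w : A ⊗[K] A) (y : A) :
    mFst (swap23 K A (w ⊗ₜ[K] y)) = w * (y ⊗ₜ[K] (1 : A)) := by
  induction w with
  | zero => simp
  | add x y hx hy => simp only [add_mul, map_add, hx, hy, TensorProduct.add_tmul]
  | tmul z t => simp [mFst_tmul, swap23_tmul]

lemma mSnd_swap (w : A ⊗[K] A) (y : A) :
    mSnd (swap23 K A (w ⊗ₜ[K] y)) = ((1 : A) ⊗ₜ[K] y) * w := by
  induction w with
  | zero => simp
  | add x y hx hy => simp only [mul_add, map_add, hx, hy, TensorProduct.add_tmul]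
  | tmul z t => simp [mSnd_tmul, swap23_tmul]

lemma hLift_tmul (a x y : A) :
    hLift D a (x ⊗ₜ[K] y) = br K A D a x ⊗ₜ[K] y + x ⊗ₜ[K] br K A D a y := by
  simp [hLift, dL_tmul, dR_tmul, mFst_tmul', mSnd_assocs, br]

lemma phiM_tmul (c x y : A) :
    phiM D c (x ⊗ₜ[K] y) = ((1 : A) ⊗ₜ[K] y) * D (x ⊗ₜ[K] c) := by
  simp [phiM, dLfst_tmul, mSnd_swap]

lemma D_mul'_left (h : LeibnizRules K A D) (E : A ⊗[K] A) (c : A) :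
    D (LinearMap.mul' K A E ⊗ₜ[K] c) =
      mFst (dLfst K A D c E) + mSnd (dLfst K A D c (flipT K A E)) := by
  induction E with
  | zero => simp
  | add x y hx hy => simp only [map_add, hx, hy, TensorProduct.add_tmul]; abel
  | tmul x y => simp [h.2, flipT_tmul, dLfst_tmul, mFst_swap, mSnd_swap, add_comm]

lemma D_mul'_right (h : LeibnizRules K A D) (b : A) (G : A ⊗[K] A) :
    D (b ⊗ₜ[K] LinearMap.mul' K A G) =
      mFst (dR K A D b G) + mSnd (dL K A D b G) := by
  induction G with
  | zero => simp
  | add x y hx hy => simp only [map_add, hx, hy, TensorProduct.tmul_add]; abel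
  | tmul x y => simp [h.1, dR_tmul, dL_tmul, mFst_assocs, mSnd_tmul']

lemma tLie_eq (h : LeibnizRules K A D) (a b c : A) :
    tLie D a b c = mFst (DJac K A D a b c) - mSnd (DJac K A D b a c)
      - phiM D c (D (b ⊗ₜ[K] a) + flipT K A (D (a ⊗ₜ[K] b))) := by
  simp only [tLie, br, D_mul'_left h, D_mul'_right h, hLift, DJac, phiM, map_add, map_sub,
    LinearMap.add_apply, LinearMap.comp_apply]
  abel

lemma br_mul (h : LeibnizRules K A D) (a b c : A) :
    br K A D a (b * c) = b * br K A D a c + br K A D a b * c := by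
  have h1 : ∀ w : A ⊗[K] A, LinearMap.mul' K A ((b ⊗ₜ[K] (1 : A)) * w) =
      b * LinearMap.mul' K A w := by
    intro w
    induction w with
    | zero => simp
    | add x y hx hy => simp only [mul_add, map_add, hx, hy]
    | tmul z t => simp [mul_assoc]
  have h2 : ∀ w : A ⊗[K] A, LinearMap.mul' K A (w * ((1 : A) ⊗ₜ[K] c)) =
      LinearMap.mul' K A w * c := by
    intro w
    induction w with
    | zero => simp
    | add x y hx hy => simp only [add_mul, map_add, hx, hy]
    | tmul z t => simp [mul_assoc]
  simp only [br, h.1, map_add, h1, h2]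

lemma hLift_l2 (h : LeibnizRules K A D) (a b : A) (F : A ⊗[K] A) :
    hLift D a (((1 : A) ⊗ₜ[K] b) * F) = ((1 : A) ⊗ₜ[K] br K A D a b) * F
      + ((1 : A) ⊗ₜ[K] b) * hLift D a F := by
  induction F with
  | zero => simp
  | add x y hx hy => simp only [mul_add, map_add, hx, hy]; abel
  | tmul x y =>
    simp [hLift_tmul, br_mul h, TensorProduct.tmul_add, mul_add]; abel

lemma hLift_r1 (h : LeibnizRules K A D) (a b : A) (F : A ⊗[K] A) :
    hLift D a (F * (b ⊗ₜ[K] (1 : A))) = F * (br K A D a b ⊗ₜ[K] (1 : A))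
      + hLift D a F * (b ⊗ₜ[K] (1 : A)) := by
  induction F with
  | zero => simp
  | add x y hx hy => simp only [add_mul, map_add, hx, hy]; abel
  | tmul x y =>
    simp [hLift_tmul, br_mul h, TensorProduct.add_tmul, add_mul]; abel

lemma tLie_mul (h : LeibnizRules K A D) (a b b' c : A) :
    tLie D a (b * b') c = ((1 : A) ⊗ₜ[K] b) * tLie D a b' c
      + tLie D a b c * (b' ⊗ₜ[K] (1 : A)) := by
  simp only [tLie, br_mul h a b b', h.2, map_add, hLift_l2 h, hLift_r1 h, TensorProduct.add_tmul,
    mul_sub, sub_mul]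
  abel

lemma mul'_hLift (h : LeibnizRules K A D) (a : A) (F : A ⊗[K] A) :
    LinearMap.mul' K A (hLift D a F) = br K A D a (LinearMap.mul' K A F) := by
  induction F with
  | zero => simp [br]
  | add x y hx hy => simp only [map_add, hx, hy]; simp [br, TensorProduct.tmul_add]
  | tmul x y => simp [hLift_tmul, br_mul h, add_comm]

lemma mul'_tLie (h : LeibnizRules K A D) (a b c : A) :
    LinearMap.mul' K A (tLie D a b c) =
      br K A D a (br K A D b c) - br K A D b (br K A D a c) - br K A D (br K A D a b) c := by
  simp only [tLie, map_sub, mul'_hLift h]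
  simp only [br]
  abel

lemma mul'_inn (a : A) (Y : A ⊗[K] A) :
    LinearMap.mul' K A (((1 : A) ⊗ₜ[K] a) * Y - Y * (a ⊗ₜ[K] (1 : A))) = 0 := by
  induction Y with
  | zero => simp
  | add x y hx hy =>
    rw [mul_add, add_mul, add_sub_add_comm, map_add, hx, hy, add_zero]
  | tmul x y => simp [mul_assoc]

lemma mul'_out (a : A) (Y : A ⊗[K] A) :
    LinearMap.mul' K A ((a ⊗ₜ[K] (1 : A)) * Y - Y * ((1 : A) ⊗ₜ[K] a)) =
      a * LinearMap.mul' K A Y - LinearMap.mul' K A Y * a := by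
  induction Y with
  | zero => simp
  | add x y hx hy =>
    rw [mul_add, add_mul, add_sub_add_comm, map_add, hx, hy, map_add]; noncomm_ring
  | tmul x y => simp [mul_assoc]

lemma mul'_flip (w : A ⊗[K] A) :
    LinearMap.mul' K A (flipT K A w) - LinearMap.mul' K A w ∈ commutatorSpan K A := by
  induction w with
  | zero => simp
  | add x y hx hy =>
    rw [map_add, map_add, map_add, add_sub_add_comm]; exact add_mem hx hy
  | tmul x y =>
    simp only [flipT_tmul, LinearMap.mul'_apply]
    exact Submodule.subset_span ⟨y, x, rfl⟩

lemma phiM_l2 (c b : A) (Y : A ⊗[K] A) :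
    phiM D c (((1 : A) ⊗ₜ[K] b) * Y) = ((1 : A) ⊗ₜ[K] b) * phiM D c Y := by
  induction Y with
  | zero => simp
  | add x y hx hy => simp only [mul_add, map_add, hx, hy]
  | tmul x y => simp [phiM_tmul, ← mul_assoc]

lemma phiM_r1 (h : LeibnizRules K A D) (c b : A) (Y : A ⊗[K] A) :
    phiM D c (Y * (b ⊗ₜ[K] (1 : A))) = phiM D c Y * (b ⊗ₜ[K] (1 : A))
      + ((1 : A) ⊗ₜ[K] LinearMap.mul' K A (flipT K A Y)) * D (b ⊗ₜ[K] c) := by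
  induction Y with
  | zero => simp
  | add x y hx hy => simp only [add_mul, map_add, hx, hy, TensorProduct.tmul_add]; abel
  | tmul x y => simp [phiM_tmul, h.2, flipT_tmul, mul_add, ← mul_assoc, add_comm]

/-- `⟪a,b⟫ + ⟪b,a⟫°`. -/
def symS (D : A ⊗[K] A →ₗ[K] A ⊗[K] A) (a b : A) : A ⊗[K] A :=
  D (a ⊗ₜ[K] b) + flipT K A (D (b ⊗ₜ[K] a))

lemma symS_mul_right (h : LeibnizRules K A D) (a b b' : A) :
    symS D a (b * b') = (b ⊗ₜ[K] (1 : A)) * symS D a b' + symS D a b * ((1 : A) ⊗ₜ[K] b') := by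
  simp only [symS, h.1, h.2, map_add, flipT_mul, flipT_tmul, mul_add, add_mul]; abel

lemma symS_mul_left (h : LeibnizRules K A D) (a a' b : A) :
    symS D (a * a') b = ((1 : A) ⊗ₜ[K] a) * symS D a' b + symS D a b * (a' ⊗ₜ[K] (1 : A)) := by
  simp only [symS, h.1, h.2, map_add, flipT_mul, flipT_tmul, mul_add, add_mul]; abel

/-- `-(λ/2)(v ⊗ 1 + 1 ⊗ v)` -/
def genY (l : K) (v : A) : A ⊗[K] A :=
  (-(l / 2)) • (v ⊗ₜ[K] (1 : A) + (1 : A) ⊗ₜ[K] v)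

lemma comm12 (a b : A) :
    (a ⊗ₜ[K] (1 : A)) * ((1 : A) ⊗ₜ[K] b) = ((1 : A) ⊗ₜ[K] b) * (a ⊗ₜ[K] (1 : A)) := by
  simp

variable {ι : Type*} {v : ι → A} {lam : ι → K}

/-- The structural data attached to `a`. -/
def Good (D : A ⊗[K] A →ₗ[K] A ⊗[K] A) (v : ι → A) (lam : ι → K) (c a : A) : Prop :=
  ∃ (Y : A ⊗[K] A) (R : (A ⊗[K] A) ⊗[K] A),
    (∀ j, symS D (v j) a = (a ⊗ₜ[K] (1 : A)) * genY (lam j) (v j)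
        - genY (lam j) (v j) * ((1 : A) ⊗ₜ[K] a)
        + (((1 : A) ⊗ₜ[K] v j) * Y - Y * (v j ⊗ₜ[K] (1 : A)))) ∧
    (∀ j, DJac K A D (v j) a c = nIns (D (v j ⊗ₜ[K] c))
        (flipT K A Y + (lam j / 2) • ((1 : A) ⊗ₜ[K] a - a ⊗ₜ[K] (1 : A)))) ∧
    (∀ j, DJac K A D a (v j) c = nIns (D (a ⊗ₜ[K] c)) (genY (lam j) (v j))
        + (((1 : A ⊗[K] A) ⊗ₜ[K] v j) * R - R * (((1 : A) ⊗ₜ[K] v j) ⊗ₜ[K] (1 : A))))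

lemma good_gen [CharZero K] (h : IsMixedDoublePoisson K A v lam D) (i k : ι) :
    Good D v lam (v k) (v i) := by
  have hh : ∀ x : K, x / 2 = x * (1/2) := fun x => by ring
  refine ⟨genY (lam i) (v i), (lam i / 2) • nIns (D (v i ⊗ₜ[K] v k)) 1, fun j => ?_, fun j => ?_,
    fun j => ?_⟩
  · rw [symS, h.1.2 j i]
    simp only [genY, mul_smul_comm, smul_mul_assoc, mul_add, add_mul,
      Algebra.TensorProduct.tmul_mul_tmul, one_mul, mul_one]
    module
  · rw [h.2 j i k, otimes1_eq, otimes1_one_eq]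
    simp only [genY, map_smul, map_add, flipT_tmul, nIns_add_right, nIns_smul_right,
      nIns_sub_right]
    module
  · rw [h.2 i j k, otimes1_eq, otimes1_one_eq, mul_smul_comm, smul_mul_assoc, ← nIns_r3, ← nIns_r2]
    simp only [genY, nIns_add_right, nIns_smul_right, mul_one, one_mul]
    module

lemma LeibnizRules.scalar_left (h : LeibnizRules K A D) (r : K) (c : A) :
    D (algebraMap K A r ⊗ₜ[K] c) = 0 := by
  rw [Algebra.algebraMap_eq_smul_one, ← TensorProduct.smul_tmul', map_smul, h.one_left, smul_zero]
lemma LeibnizRules.scalar_right (h : LeibnizRules K A D) (r : K) (c : A) :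
    D (c ⊗ₜ[K] algebraMap K A r) = 0 := by
  rw [Algebra.algebraMap_eq_smul_one, TensorProduct.tmul_smul, map_smul, h.one_right, smul_zero]
lemma scalar_tmul_one (r : K) : algebraMap K A r ⊗ₜ[K] (1 : A) = r • (1 : A ⊗[K] A) := by
  rw [Algebra.algebraMap_eq_smul_one, ← TensorProduct.smul_tmul', Algebra.TensorProduct.one_def]
lemma one_tmul_scalar (r : K) : (1 : A) ⊗ₜ[K] algebraMap K A r = r • (1 : A ⊗[K] A) := by
  rw [Algebra.algebraMap_eq_smul_one, TensorProduct.tmul_smul, Algebra.TensorProduct.one_def]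

lemma good_one (h : LeibnizRules K A D) (c : A) (r : K) :
    Good D v lam c (algebraMap K A r) := by
  refine ⟨0, 0, fun j => ?_, fun j => ?_, fun j => ?_⟩
  · rw [symS, h.scalar_left, h.scalar_right, scalar_tmul_one, one_tmul_scalar]
    simp
  · have : ∀ w, dR K A D (algebraMap K A r) w = 0 := by
      intro w
      induction w with
      | zero => simp
      | add x y hx hy => rw [map_add, hx, hy, add_zero]
      | tmul x y => rw [dR_tmul, h.scalar_left, TensorProduct.tmul_zero, map_zero]
    rw [DJac, this, h.scalar_left, h.scalar_right, scalar_tmul_one, one_tmul_scalar]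
    simp [nIns_zero_right]
  · have : ∀ w, dL K A D (algebraMap K A r) w = 0 := by
      intro w
      induction w with
      | zero => simp
      | add x y hx hy => rw [map_add, hx, hy, add_zero]
      | tmul x y => rw [dL_tmul, h.scalar_left, TensorProduct.zero_tmul]
    rw [DJac, this, h.scalar_left, h.scalar_left]
    simp [nIns_zero_left]

lemma DJac_add_left (a a' b c : A) : DJac K A D (a + a') b c = DJac K A D a b c + DJac K A D a' b c := by
  have : ∀ w, dL K A D (a + a') w = dL K A D a w + dL K A D a' w := by
    intro w
    induction w with
    | zero => simp
    | add x y hx hy => rw [map_add, hx, hy, map_add, map_add]; abel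
    | tmul x y => simp [dL_tmul, TensorProduct.add_tmul]
  simp only [DJac, this, TensorProduct.add_tmul, map_add]; abel

lemma DJac_add_mid (a b b' c : A) : DJac K A D a (b + b') c = DJac K A D a b c + DJac K A D a b' c := by
  have : ∀ w, dR K A D (b + b') w = dR K A D b w + dR K A D b' w := by
    intro w
    induction w with
    | zero => simp
    | add x y hx hy => rw [map_add, hx, hy, map_add, map_add]; abel
    | tmul x y => simp [dR_tmul, TensorProduct.add_tmul, TensorProduct.tmul_add]
  simp only [DJac, this, TensorProduct.add_tmul, TensorProduct.tmul_add, map_add]; abel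

lemma good_add (c a b : A) (ha : Good D v lam c a) (hb : Good D v lam c b) :
    Good D v lam c (a + b) := by
  obtain ⟨Y, R, h1, h2, h3⟩ := ha
  obtain ⟨Y', R', h1', h2', h3'⟩ := hb
  refine ⟨Y + Y', R + R', fun j => ?_, fun j => ?_, fun j => ?_⟩
  · have : symS D (v j) (a + b) = symS D (v j) a + symS D (v j) b := by
      simp only [symS, TensorProduct.add_tmul, TensorProduct.tmul_add, map_add]; abel
    rw [this, h1, h1', TensorProduct.add_tmul, TensorProduct.tmul_add]
    noncomm_ring
  · rw [DJac_add_mid, h2, h2', ← nIns_add_right, TensorProduct.add_tmul, TensorProduct.tmul_add,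
      map_add]
    congr 1
    module
  · rw [DJac_add_left, h3, h3', TensorProduct.add_tmul, map_add, nIns_add_left]
    noncomm_ring

lemma good_mul (h : LeibnizRules K A D) (c a b : A) (ha : Good D v lam c a)
    (hb : Good D v lam c b) : Good D v lam c (a * b) := by
  obtain ⟨Y, R, h1, h2, h3⟩ := ha
  obtain ⟨Y', R', h1', h2', h3'⟩ := hb
  have e1 : (a * b) ⊗ₜ[K] (1 : A) = (a ⊗ₜ[K] (1 : A)) * (b ⊗ₜ[K] (1 : A)) := by simp
  have e2 : (1 : A) ⊗ₜ[K] (a * b) = ((1 : A) ⊗ₜ[K] a) * ((1 : A) ⊗ₜ[K] b) := by simp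
  refine ⟨(a ⊗ₜ[K] (1 : A)) * Y' + Y * ((1 : A) ⊗ₜ[K] b),
    (((1 : A) ⊗ₜ[K] a) ⊗ₜ[K] (1 : A)) * R' + R * ((b ⊗ₜ[K] (1 : A)) ⊗ₜ[K] (1 : A))
      - nIns (D (b ⊗ₜ[K] c)) Y, fun j => ?_, fun j => ?_, fun j => ?_⟩
  · rw [symS_mul_right h, h1, h1', e1, e2]
    have c1 := comm12 (K := K) a (v j)
    have c2 := comm12 (K := K) (v j) b
    linear_combination (norm := noncomm_ring) c1 * Y' - Y * c2
  · rw [DJac_mul_mid h, h2, h2', ← nIns_r3, ← nIns_r2, ← nIns_add_right, map_add, flipT_mul,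
      flipT_mul, flipT_tmul, flipT_tmul, e1, e2]
    congr 1
    simp only [mul_add, add_mul, mul_smul_comm, smul_mul_assoc, mul_sub, sub_mul]
    module
  · have hs : D (v j ⊗ₜ[K] a) + flipT K A (D (a ⊗ₜ[K] v j)) = symS D (v j) a := rfl
    rw [DJac_mul_left h, h3, h3', hs, h1, h.2 a b c, nIns_add_left, nIns_w2, nIns_w1]
    simp only [nIns_add_right, nIns_sub_right, nIns_l2, nIns_r3, nIns_r2]
    have c1 : (((1 : A) ⊗ₜ[K] a) ⊗ₜ[K] (1 : A)) * ((1 : A ⊗[K] A) ⊗ₜ[K] v j) =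
      ((1 : A ⊗[K] A) ⊗ₜ[K] v j) * (((1 : A) ⊗ₜ[K] a) ⊗ₜ[K] (1 : A)) := by simp
    have c2 : (((1 : A) ⊗ₜ[K] v j) ⊗ₜ[K] (1 : A)) * ((b ⊗ₜ[K] (1 : A)) ⊗ₜ[K] (1 : A)) =
      ((b ⊗ₜ[K] (1 : A)) ⊗ₜ[K] (1 : A)) * (((1 : A) ⊗ₜ[K] v j) ⊗ₜ[K] (1 : A)) := by simp
    have c2' : ∀ R : (A ⊗[K] A) ⊗[K] A,
        R * (((1 : A) ⊗ₜ[K] v j) ⊗ₜ[K] (1 : A)) * ((b ⊗ₜ[K] (1 : A)) ⊗ₜ[K] (1 : A)) =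
        R * ((b ⊗ₜ[K] (1 : A)) ⊗ₜ[K] (1 : A)) * (((1 : A) ⊗ₜ[K] v j) ⊗ₜ[K] (1 : A)) := by
      intro R
      rw [mul_assoc, c2, mul_assoc]
    simp only [mul_add, add_mul, mul_sub, sub_mul, ← mul_assoc, c1, c2']
    abel

/-- `T_a(v_j, c)` is an inner derivation evaluated at `v_j`. -/
lemma good_tLie (h : LeibnizRules K A D) (c a : A) (ha : Good D v lam c a) :
    ∃ Z : A ⊗[K] A, ∀ j, tLie D a (v j) c =
      ((1 : A) ⊗ₜ[K] v j) * Z - Z * (v j ⊗ₜ[K] (1 : A)) := by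
  obtain ⟨Y, R, h1, h2, h3⟩ := ha
  refine ⟨mFst R - phiM D c Y, fun j => ?_⟩
  have hs : D (v j ⊗ₜ[K] a) + flipT K A (D (a ⊗ₜ[K] v j)) = symS D (v j) a := rfl
  rw [tLie_eq h, hs, h1, h2, h3]
  simp only [map_add, map_sub, mFst_l3, mFst_r2, phiM_l2, phiM_r1 h, mSnd_nIns]
  have e : phiM D c ((a ⊗ₜ[K] (1 : A)) * genY (lam j) (v j)) -
      phiM D c (genY (lam j) (v j) * ((1 : A) ⊗ₜ[K] a)) =
      mFst (nIns (D (a ⊗ₜ[K] c)) (genY (lam j) (v j))) := by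
    simp only [genY, mul_smul_comm, smul_mul_assoc, mul_add, add_mul, map_smul, map_add,
      nIns_add_right, nIns_smul_right, mFst_nIns_left, mFst_nIns_right,
      Algebra.TensorProduct.tmul_mul_tmul, one_mul, mul_one, phiM_tmul, h.2, h.one_left,
      ← Algebra.TensorProduct.one_def, mul_zero]
    module
  rw [e]
  simp only [map_smul, map_sub, LinearMap.mul'_apply, one_mul, mul_one, sub_self, smul_zero,
    add_zero, mul_sub, sub_mul]
  abel

end aux

theorem stmt0 {K : Type*} [Field K] [IsAlgClosed K] [CharZero K]
    {d : ℕ} (hd : 1 ≤ d) (lam : Fin d → K)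
    (D : FreeAlgebra K (Fin d) ⊗[K] FreeAlgebra K (Fin d) →ₗ[K] FreeAlgebra K (Fin d) ⊗[K] FreeAlgebra K (Fin d))
    (hD : IsMixedDoublePoisson K (FreeAlgebra K (Fin d)) (FreeAlgebra.ι K) lam D) :
    IsModifiedDoublePoisson K (FreeAlgebra K (Fin d)) D := by
  obtain ⟨hM, hP⟩ := id hD
  have hL := hM.1
  have good : ∀ k a, Good D (FreeAlgebra.ι K) lam (FreeAlgebra.ι K k) a := by
    intro k a
    induction a using FreeAlgebra.induction with
    | grade0 r => exact good_one hL _ r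
    | grade1 i => exact good_gen hD i k
    | mul a b ha hb => exact good_mul hL _ a b ha hb
    | add a b ha hb => exact good_add _ a b ha hb
  refine ⟨hL, fun a b => ?_, fun a b c => ?_⟩
  · obtain ⟨Y, R, h1, -, -⟩ := good ⟨0, hd⟩ b
    have key : ∃ X : FreeAlgebra K (Fin d) ⊗[K] FreeAlgebra K (Fin d),
        symS D a b = (b ⊗ₜ[K] 1) * X - X * (1 ⊗ₜ[K] b)
          + ((1 ⊗ₜ[K] a) * Y - Y * (a ⊗ₜ[K] 1)) := by
      induction a using FreeAlgebra.induction with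
      | grade0 r =>
        refine ⟨0, ?_⟩
        rw [symS, hL.scalar_left, hL.scalar_right, scalar_tmul_one, one_tmul_scalar]
        simp
      | grade1 i => exact ⟨_, h1 i⟩
      | add a a' ha ha' =>
        obtain ⟨X, hX⟩ := ha
        obtain ⟨X', hX'⟩ := ha'
        refine ⟨X + X', ?_⟩
        have : symS D (a + a') b = symS D a b + symS D a' b := by
          simp only [symS, TensorProduct.add_tmul, TensorProduct.tmul_add, map_add]; abel
        rw [this, hX, hX', TensorProduct.add_tmul, TensorProduct.tmul_add]
        simp only [mul_add, add_mul]
        abel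
      | mul a a' ha ha' =>
        obtain ⟨X, hX⟩ := ha
        obtain ⟨X', hX'⟩ := ha'
        refine ⟨(1 ⊗ₜ[K] a) * X' + X * (a' ⊗ₜ[K] 1), ?_⟩
        have e1 : (a * a') ⊗ₜ[K] (1 : FreeAlgebra K (Fin d)) =
          (a ⊗ₜ[K] 1) * (a' ⊗ₜ[K] 1) := by simp
        have e2 : (1 : FreeAlgebra K (Fin d)) ⊗ₜ[K] (a * a') =
          (1 ⊗ₜ[K] a) * (1 ⊗ₜ[K] a') := by simp
        have c2 : ∀ X : FreeAlgebra K (Fin d) ⊗[K] FreeAlgebra K (Fin d),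
            X * (a' ⊗ₜ[K] 1) * (1 ⊗ₜ[K] b) = X * (1 ⊗ₜ[K] b) * (a' ⊗ₜ[K] 1) := by
          intro X
          rw [mul_assoc, comm12, mul_assoc]
        rw [symS_mul_left hL, hX, hX', e1, e2]
        simp only [mul_add, add_mul, mul_sub, sub_mul, ← mul_assoc, comm12 b a, c2]
        abel
    obtain ⟨X, hX⟩ := key
    have h2 := congrArg (LinearMap.mul' K (FreeAlgebra K (Fin d))) hX
    rw [map_add, mul'_out, mul'_inn, add_zero, symS, map_add] at h2
    have h3 := mul'_flip (D (b ⊗ₜ[K] a))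
    have h4 : b * LinearMap.mul' K _ X - LinearMap.mul' K _ X * b ∈
        commutatorSpan K (FreeAlgebra K (Fin d)) := Submodule.subset_span ⟨_, _, rfl⟩
    rw [← h2] at h4
    have := sub_mem h4 h3
    simp only [br]
    convert this using 1
    abel
  · induction c using FreeAlgebra.induction with
    | grade0 r =>
      have : ∀ a, br K _ D a (algebraMap K _ r) = 0 := by
        intro a
        rw [br, hL.scalar_right, map_zero]
      simp [this]
      simp [br]
    | add x y hx hy =>
      have e : ∀ a x y, br K _ D a (x + y) = br K _ D a x + br K _ D a y := by
        intro a x y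
        simp [br, TensorProduct.tmul_add]
      simp only [e]
      rw [← add_zero (0 : FreeAlgebra K (Fin d))]
      nth_rw 1 [← hx]
      rw [← hy]
      abel
    | mul x y hx hy =>
      have e : ∀ a x y, br K _ D a (x + y) = br K _ D a x + br K _ D a y := by
        intro a x y
        simp [br, TensorProduct.tmul_add]
      simp only [br_mul hL, e]
      have h1 := congrArg (x * ·) hy
      have h2 := congrArg (· * y) hx
      simp only [mul_zero, zero_mul, mul_sub, sub_mul] at h1 h2
      rw [← add_zero (0 : FreeAlgebra K (Fin d))]
      nth_rw 1 [← h1]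
      rw [← h2]
      abel
    | grade1 k =>
      obtain ⟨Z, hZ⟩ := good_tLie hL _ _ (good k a)
      have key : tLie D a b (FreeAlgebra.ι K k) = (1 ⊗ₜ[K] b) * Z - Z * (b ⊗ₜ[K] 1) := by
        induction b using FreeAlgebra.induction with
        | grade0 r =>
          rw [tLie, br, hL.scalar_left, hL.scalar_left, hL.scalar_right, scalar_tmul_one,
            one_tmul_scalar]
          simp
        | grade1 i => exact hZ i
        | add x y hx hy =>
          have : tLie D a (x + y) (FreeAlgebra.ι K k) = tLie D a x (FreeAlgebra.ι K k)
              + tLie D a y (FreeAlgebra.ι K k) := by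
            simp only [tLie, br, TensorProduct.add_tmul, TensorProduct.tmul_add, map_add]
            abel
          rw [this, hx, hy, TensorProduct.add_tmul, TensorProduct.tmul_add]
          simp only [mul_add, add_mul]
          abel
        | mul x y hx hy =>
          have e1 : (x * y) ⊗ₜ[K] (1 : FreeAlgebra K (Fin d)) =
            (x ⊗ₜ[K] 1) * (y ⊗ₜ[K] 1) := by simp
          have e2 : (1 : FreeAlgebra K (Fin d)) ⊗ₜ[K] (x * y) =
            (1 ⊗ₜ[K] x) * (1 ⊗ₜ[K] y) := by simp
          rw [tLie_mul hL, hx, hy, e1, e2]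
          simp only [mul_sub, sub_mul, ← mul_assoc]
          abel
      rw [← mul'_tLie hL, key, mul'_inn]
end

section
/- Let K be an algebraically closed field of characteristic zero and A = K⟨x1,x2,x3⟩ the free associative K-algebra. Every K-linear map ⟪-,-⟫ : A⊗A → A⊗A satisfying the Leibniz rules whose values on pairs of generators are ⟪x1,x2⟫ = −(x2x1)⊗1, ⟪x2,x1⟫ = (x1x2)⊗1, ⟪x2,x3⟫ = −x2⊗x3, ⟪x3,x2⟫ = x2⊗x3, ⟪x3,x1⟫ = −1⊗(x3x1), ⟪x1,x3⟫ = 1⊗(x1x3), and ⟪x_i,x_i⟫ = 0 for i = 1,2,3, is a modified double Poisson bracket on A. -/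
open TensorProduct

noncomputable section

namespace Aux

variable {K : Type*} [Field K]

local notation "FA" => FreeAlgebra K (Fin 3)

/-- the matrix representation computing the double derivation `d/dx_i` -/
def dmat (K : Type*) [Field K] (i : Fin 3) :
    FreeAlgebra K (Fin 3) →ₐ[K] Matrix (Fin 2) (Fin 2) (FreeAlgebra K (Fin 3) ⊗[K] FreeAlgebra K (Fin 3)) :=
  FreeAlgebra.lift K fun k =>
    !![FreeAlgebra.ι K k ⊗ₜ[K] (1 : FreeAlgebra K (Fin 3)), if k = i then 1 else 0;
      0, (1 : FreeAlgebra K (Fin 3)) ⊗ₜ[K] FreeAlgebra.ι K k]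

lemma one_eq : (1 : FA ⊗[K] FA) = (1 : FA) ⊗ₜ[K] (1 : FA) := rfl

lemma dmat_diag (i : Fin 3) (a : FA) :
    dmat K i a 0 0 = a ⊗ₜ[K] (1 : FA) ∧ dmat K i a 1 1 = (1 : FA) ⊗ₜ[K] a ∧ dmat K i a 1 0 = 0 := by
  induction a using FreeAlgebra.induction with
  | grade0 r =>
    simp only [AlgHom.commutes, Matrix.algebraMap_matrix_apply]
    simp [Algebra.algebraMap_eq_smul_one, ← TensorProduct.smul_tmul', one_eq]
  | grade1 k => simp [dmat]
  | mul a b ha hb =>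
    obtain ⟨h1, h2, h3⟩ := ha
    obtain ⟨g1, g2, g3⟩ := hb
    simp [Matrix.mul_apply, Fin.sum_univ_two, h1, h2, h3, g1, g2, g3]
  | add a b ha hb =>
    obtain ⟨h1, h2, h3⟩ := ha
    obtain ⟨g1, g2, g3⟩ := hb
    simp [h1, h2, h3, g1, g2, g3, TensorProduct.add_tmul, TensorProduct.tmul_add]

/-- the double derivation -/
def dd (K : Type*) [Field K] (i : Fin 3) :
    FreeAlgebra K (Fin 3) →ₗ[K] FreeAlgebra K (Fin 3) ⊗[K] FreeAlgebra K (Fin 3) where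
  toFun a := dmat K i a 0 1
  map_add' a b := by simp
  map_smul' r a := by simp

lemma dd_mul (i : Fin 3) (a b : FA) :
    dd K i (a * b) = (a ⊗ₜ[K] (1 : FA)) * dd K i b + dd K i a * ((1 : FA) ⊗ₜ[K] b) := by
  simp [dd, Matrix.mul_apply, Fin.sum_univ_two, (dmat_diag i a).1, (dmat_diag i b).2.1]

lemma dd_ι (i k : Fin 3) : dd K i (FreeAlgebra.ι K k) = if k = i then 1 else 0 := by
  simp [dd, dmat]

/-- `u ⊗ v ↦ u h v` -/
def mid (h : FA) : FA ⊗[K] FA →ₗ[K] FA :=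
  LinearMap.mul' K FA ∘ₗ LinearMap.rTensor FA (LinearMap.mulRight K h)

lemma mid_tmul (h u v : FA) : mid h (u ⊗ₜ[K] v) = u * h * v := by simp [mid]

/-- `u ⊗ v ↦ v h u` -/
def out (h : FA) : FA ⊗[K] FA →ₗ[K] FA :=
  mid h ∘ₗ (TensorProduct.comm K FA FA).toLinearMap

lemma out_tmul (h u v : FA) : out h (u ⊗ₜ[K] v) = v * h * u := by simp [out, mid_tmul]

lemma mid_left (h b : FA) (w : FA ⊗[K] FA) : mid h ((b ⊗ₜ[K] (1 : FA)) * w) = b * mid h w := by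
  induction w with
  | zero => simp
  | tmul u v => simp [mid_tmul, mul_assoc]
  | add u v hu hv => simp [mul_add, hu, hv]

lemma mid_right (h b : FA) (w : FA ⊗[K] FA) : mid h (w * ((1 : FA) ⊗ₜ[K] b)) = mid h w * b := by
  induction w with
  | zero => simp
  | tmul u v => simp [mid_tmul, mul_assoc]
  | add u v hu hv => simp [add_mul, hu, hv]

lemma mid_inl (h b : FA) (w : FA ⊗[K] FA) : mid h (((1 : FA) ⊗ₜ[K] b) * w) = mid (h * b) w := by
  induction w with
  | zero => simp
  | tmul u v => simp [mid_tmul, mul_assoc]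
  | add u v hu hv => simp [mul_add, hu, hv]

lemma mid_inr (h b : FA) (w : FA ⊗[K] FA) : mid h (w * (b ⊗ₜ[K] (1 : FA))) = mid (b * h) w := by
  induction w with
  | zero => simp
  | tmul u v => simp [mid_tmul, mul_assoc]
  | add u v hu hv => simp [add_mul, hu, hv]

lemma out_left (h b : FA) (w : FA ⊗[K] FA) : out h ((b ⊗ₜ[K] (1 : FA)) * w) = out (h * b) w := by
  induction w with
  | zero => simp
  | tmul u v => simp [out_tmul, mul_assoc]
  | add u v hu hv => simp [mul_add, hu, hv]

lemma out_right (h b : FA) (w : FA ⊗[K] FA) : out h (w * ((1 : FA) ⊗ₜ[K] b)) = out (b * h) w := by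
  induction w with
  | zero => simp
  | tmul u v => simp [out_tmul, mul_assoc]
  | add u v hu hv => simp [add_mul, hu, hv]

lemma mid_add (g h : FA) (w : FA ⊗[K] FA) : mid (g + h) w = mid g w + mid h w := by
  induction w with
  | zero => simp
  | tmul u v => simp [mid_tmul, mul_add, add_mul]
  | add u v hu hv => simp only [map_add, hu, hv]; abel

lemma mid_smul (r : K) (h : FA) (w : FA ⊗[K] FA) : mid (r • h) w = r • mid h w := by
  induction w with
  | zero => simp
  | tmul u v => simp [mid_tmul]
  | add u v hu hv => simp only [map_add, hu, hv, smul_add]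

/-- insertion derivative, `w' x_i w'' ↦ w' h w''` -/
def I (i : Fin 3) (a h : FA) : FA := mid h (dd K i a)

/-- cyclic derivative with insertion, `w' x_i w'' ↦ w'' h w'` -/
def E (i : Fin 3) (a h : FA) : FA := out h (dd K i a)

lemma I_add (i : Fin 3) (a b h : FA) : I i (a + b) h = I i a h + I i b h := by simp [I]
lemma E_add (i : Fin 3) (a b h : FA) : E i (a + b) h = E i a h + E i b h := by simp [E]
lemma I_sub (i : Fin 3) (a b h : FA) : I i (a - b) h = I i a h - I i b h := by simp [I]
lemma E_sub (i : Fin 3) (a b h : FA) : E i (a - b) h = E i a h - E i b h := by simp [E]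
lemma E_zero (i : Fin 3) (h : FA) : E i 0 h = 0 := by simp [E]
lemma I_add' (i : Fin 3) (a g h : FA) : I i a (g + h) = I i a g + I i a h := by simp [I, mid_add]
lemma E_add' (i : Fin 3) (a g h : FA) : E i a (g + h) = E i a g + E i a h := by
  simp [E, out, mid_add]
lemma mid_zero (w : FA ⊗[K] FA) : mid (0 : FA) w = 0 := by
  simpa using mid_smul (0 : K) 0 w
lemma I_zero' (i : Fin 3) (a : FA) : I i a 0 = 0 := mid_zero _
lemma E_zero' (i : Fin 3) (a : FA) : E i a 0 = 0 := mid_zero _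
lemma I_sub' (i : Fin 3) (a g h : FA) : I i a (g - h) = I i a g - I i a h := by
  rw [eq_sub_iff_add_eq, ← I_add', sub_add_cancel]
lemma E_sub' (i : Fin 3) (a g h : FA) : E i a (g - h) = E i a g - E i a h := by
  rw [eq_sub_iff_add_eq, ← E_add', sub_add_cancel]
lemma I_neg' (i : Fin 3) (a g : FA) : I i a (-g) = - I i a g := by
  have := I_sub' i a 0 g
  simpa [I_zero'] using this
lemma I_mul (i : Fin 3) (a b h : FA) : I i (a * b) h = a * I i b h + I i a h * b := by
  simp [I, dd_mul, mid_left, mid_right]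
lemma E_mul (i : Fin 3) (a b h : FA) : E i (a * b) h = E i b (h * a) + E i a (b * h) := by
  simp [E, dd_mul, out_left, out_right]
lemma I_ι (i k : Fin 3) (h : FA) : I i (FreeAlgebra.ι K k) h = if k = i then h else 0 := by
  simp only [I, dd_ι]; split_ifs <;> simp [one_eq, mid_tmul]
lemma E_ι (i k : Fin 3) (h : FA) : E i (FreeAlgebra.ι K k) h = if k = i then h else 0 := by
  simp only [E, dd_ι]; split_ifs <;> simp [one_eq, out_tmul]
lemma dd_alg (i : Fin 3) (r : K) : dd K i (algebraMap K FA r) = 0 := by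
  simp [dd, Matrix.algebraMap_matrix_apply]
lemma I_alg (i : Fin 3) (r : K) (h : FA) : I i (algebraMap K FA r) h = 0 := by simp [I, dd_alg]
lemma E_alg (i : Fin 3) (r : K) (h : FA) : E i (algebraMap K FA r) h = 0 := by simp [E, dd_alg]
lemma I_one (i : Fin 3) (h : FA) : I i 1 h = 0 := by simpa using I_alg i (1 : K) h
lemma E_one (i : Fin 3) (h : FA) : E i 1 h = 0 := by simpa using E_alg i (1 : K) h

/-- derivations -/
def IsDer (X : FA →ₗ[K] FA) : Prop := ∀ a b, X (a * b) = a * X b + X a * b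

lemma IsDer.one {X : FA →ₗ[K] FA} (hX : IsDer X) : X 1 = 0 := by
  have := hX 1 1
  simpa using this

lemma IsDer.alg {X : FA →ₗ[K] FA} (hX : IsDer X) (r : K) : X (algebraMap K FA r) = 0 := by
  rw [Algebra.algebraMap_eq_smul_one, map_smul, hX.one, smul_zero]

lemma der_eq {X : FA →ₗ[K] FA} (hX : IsDer X) (w : FA) :
    X w = ∑ k, I k w (X (FreeAlgebra.ι K k)) := by
  induction w using FreeAlgebra.induction with
  | grade0 r => simp [hX.alg, I_alg]
  | grade1 k => simp [I_ι]
  | mul a b ha hb => rw [hX, hb, ha]; simp [I_mul, Finset.sum_add_distrib, Finset.mul_sum, Finset.sum_mul]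
  | add a b ha hb => rw [map_add, hb, ha]; simp [I_add, Finset.sum_add_distrib]

lemma E_der {X : FA →ₗ[K] FA} (hX : IsDer X) (i : Fin 3) (b : FA) : ∀ h : FA,
    E i (X b) h = X (E i b h) - E i b (X h) + ∑ k, E i (X (FreeAlgebra.ι K k)) (E k b h) := by
  induction b using FreeAlgebra.induction with
  | grade0 r => intro h; simp [hX.alg, E_alg, E_zero, E_zero']
  | grade1 k => intro h; simp only [E_ι]; fin_cases k <;> fin_cases i <;> simp [Fin.sum_univ_three, E_zero']
  | mul a b ha hb =>
    intro h
    rw [hX, E_add, E_mul, E_mul, ha, hb, E_mul, E_mul, map_add, hX, hX, E_add', E_add']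
    simp only [E_mul, E_add', Finset.sum_add_distrib]
    abel
  | add a b ha hb => intro h; simp only [map_add, E_add, ha, hb, E_add', Finset.sum_add_distrib]; abel

lemma hess (i k : Fin 3) (h : FA) (a : FA) : ∀ g : FA,
    E k (E i a g) h = I i (E k a g) h + E k g (I i a h) - E k a (I i g h) := by
  induction a using FreeAlgebra.induction with
  | grade0 r => intro g; rw [E_alg, E_alg, E_alg, I_alg, E_zero, E_zero']; simp [I]
  | grade1 j =>
    intro g
    simp only [E_ι, I_ι]
    split_ifs <;> simp [E_zero, E_zero', I]
  | mul a b ha hb =>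
    intro g
    rw [E_mul, E_add, ha, hb, E_mul, E_mul, E_mul, E_mul, I_add, I_mul, I_mul, I_mul]
    simp only [E_add']
    abel
  | add a b ha hb => intro g; simp only [E_add, I_add, ha, hb, E_add']; abel

lemma hess1 (i k : Fin 3) (a h : FA) : E k (E i a 1) h = I i (E k a 1) h := by
  rw [hess, E_one, I_one, E_zero']; simp

lemma tele (a : FA) : ∀ h : FA,
    ∑ k, (FreeAlgebra.ι K k * E k a h - E k a h * FreeAlgebra.ι K k) = a * h - h * a := by
  induction a using FreeAlgebra.induction with
  | grade0 r => intro h; simp [E_alg, Algebra.commutes]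
  | grade1 k => intro h; simp only [E_ι]; fin_cases k <;> simp
  | mul a b ha hb =>
    intro h
    have h1 := ha (b * h)
    have h2 := hb (h * a)
    have : a * b * h - h * (a * b) = (b * (h * a) - h * a * b) + (a * (b * h) - b * h * a) := by
      noncomm_ring
    rw [this, ← h1, ← h2, ← Finset.sum_add_distrib]
    refine Finset.sum_congr rfl fun k _ => ?_
    rw [E_mul, mul_add, add_mul]; abel
  | add a b ha hb =>
    intro h
    have : (a + b) * h - h * (a + b) = (a * h - h * a) + (b * h - h * b) := by noncomm_ring
    rw [this, ← ha, ← hb, ← Finset.sum_add_distrib]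
    refine Finset.sum_congr rfl fun k _ => ?_
    rw [E_add, mul_add, add_mul]; abel

lemma comm_mem (a b : FA) : a * b - b * a ∈ commutatorSpan K FA :=
  Submodule.subset_span ⟨a, b, rfl⟩

lemma I_comm (k : Fin 3) (h : FA) (b : FA) : ∀ g : FA,
    g * I k b h - E k b g * h ∈ commutatorSpan K FA := by
  induction b using FreeAlgebra.induction with
  | grade0 r => intro g; simp [E_alg, I_alg]
  | grade1 j => intro g; simp only [E_ι, I_ι]; split_ifs <;> simp
  | mul a b ha hb =>
    intro g
    have := add_mem (add_mem (ha (b * g)) (hb (g * a))) (comm_mem (g * I k a h) b)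
    convert this using 1
    rw [I_mul, E_mul]
    noncomm_ring
  | add a b ha hb =>
    intro g
    convert add_mem (ha g) (hb g) using 1
    rw [I_add, E_add]; noncomm_ring

lemma mid_D (D : FA ⊗[K] FA →ₗ[K] FA ⊗[K] FA) (hL : LeibnizRules K FA D) (c a : FA) : ∀ h : FA,
    mid h (D (a ⊗ₜ[K] c)) = ∑ i, mid (E i a h) (D (FreeAlgebra.ι K i ⊗ₜ[K] c)) := by
  have one : D ((1 : FA) ⊗ₜ[K] c) = 0 := by
    have := hL.2 1 1 c
    rw [← one_eq, one_mul, one_mul, mul_one] at this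
    simpa using this
  induction a using FreeAlgebra.induction with
  | grade0 r =>
    intro h
    rw [Algebra.algebraMap_eq_smul_one, ← TensorProduct.smul_tmul', map_smul, one, smul_zero,
      ← Algebra.algebraMap_eq_smul_one]
    simp [E_alg, mid_zero]
  | grade1 k => intro h; simp only [E_ι]; fin_cases k <;> simp [Fin.sum_univ_three, mid_zero]
  | mul a b ha hb =>
    intro h
    rw [hL.2, map_add, mid_inl, mid_inr, ha, hb]
    simp [E_mul, mid_add, Finset.sum_add_distrib]
  | add a b ha hb =>
    intro h
    rw [TensorProduct.add_tmul, map_add, map_add, ha, hb]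
    simp [E_add, mid_add, Finset.sum_add_distrib]

lemma br_eq (D : FA ⊗[K] FA →ₗ[K] FA ⊗[K] FA) (a c : FA) :
    br K FA D a c = mid 1 (D (a ⊗ₜ[K] c)) := by
  simp [br, mid]

/-- the bracket as a linear map in the second argument -/
def ham (D : FA ⊗[K] FA →ₗ[K] FA ⊗[K] FA) (a : FA) : FA →ₗ[K] FA :=
  LinearMap.mul' K FA ∘ₗ D ∘ₗ TensorProduct.mk K FA FA a

lemma ham_apply (D : FA ⊗[K] FA →ₗ[K] FA ⊗[K] FA) (a c : FA) : br K FA D a c = ham D a c := rfl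

lemma ham_der (D : FA ⊗[K] FA →ₗ[K] FA ⊗[K] FA) (hL : LeibnizRules K FA D) (a : FA) :
    IsDer (ham D a) := by
  intro b c
  simp only [← ham_apply, br_eq, hL.1, map_add, mid_left, mid_right]

/-- inner derivation -/
def inn (z : FA) : FA →ₗ[K] FA := LinearMap.mulRight K z - LinearMap.mulLeft K z

lemma inn_apply (z a : FA) : inn z a = a * z - z * a := by simp [inn]

lemma inn_der (z : FA) : IsDer (inn (K := K) z) := by
  intro a b; simp only [inn_apply]; noncomm_ring

lemma der_ext {X Y : FA →ₗ[K] FA} (hX : IsDer X) (hY : IsDer Y)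
    (h : ∀ k, X (FreeAlgebra.ι K k) = Y (FreeAlgebra.ι K k)) (w : FA) : X w = Y w := by
  rw [der_eq hX, der_eq hY]; simp [h]


section ringlemmas

variable {R : Type*} [Ring R]

lemma ring_skew (x1 x2 x3 p1 p2 p3 q1 q2 q3 : R)
    (sp : x1 * p1 - p1 * x1 + (x2 * p2 - p2 * x2) + (x3 * p3 - p3 * x3) = 0)
    (sq : x1 * q1 - q1 * x1 + (x2 * q2 - q2 * x2) + (x3 * q3 - q3 * x3) = 0) :
    q1 * (x1 * (x2 * p2) - p3 * x3 * x1) + q2 * (x2 * (p3 * x3 - x1 * p1))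
      + q3 * ((p1 * x1 - x2 * p2) * x3)
      + (p1 * (x1 * (x2 * q2) - q3 * x3 * x1) + p2 * (x2 * (q3 * x3 - x1 * q1))
      + p3 * ((q1 * x1 - x2 * q2) * x3)) =
      (q1 * x1 * x2 * (p2) - p2 * (q1 * x1 * x2)) +
      (p2 * q1 * x1 * (x2) - x2 * (p2 * q1 * x1)) +
      (p3 * x3 * x1 * (q1) - q1 * (p3 * x3 * x1)) +
      (x1 * q1 * (p3 * x3) - p3 * x3 * (x1 * q1)) +
      (q3 * x3 * x1 * (p1) - p1 * (q3 * x3 * x1)) +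
      (p2 * x2 * (q3 * x3) - q3 * x3 * (p2 * x2)) +
      (x1 * q1 * (p2 * x2) - p2 * x2 * (x1 * q1)) +
      (p2 * x3 * (q3 * x2) - q3 * x2 * (p2 * x3)) +
      (x2 * (p2 * x3 * q3) - p2 * x3 * q3 * (x2)) +
      (q3 * (p1 * x1 * x3) - p1 * x1 * x3 * (q3)) +
      (x3 * (p3 * x2 * q2) - p3 * x2 * q2 * (x3)) +
      (p3 * q1 * x1 * (x3) - x3 * (p3 * q1 * x1)) +
      (p1 * (x1 * q1 * x1) - x1 * q1 * x1 * (p1)) +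
      (x1 * q1 * (p1 * x1) - p1 * x1 * (x1 * q1)) +
      (p2 * (x1 * q1 * x2) - x1 * q1 * x2 * (p2)) +
      (x2 * (p2 * x1 * q1) - p2 * x1 * q1 * (x2)) +
      (p3 * (x1 * q1 * x3) - x1 * q1 * x3 * (p3)) +
      (x3 * (p3 * x1 * q1) - p3 * x1 * q1 * (x3)) +
      (p1 * x1 * (q2 * x2) - q2 * x2 * (p1 * x1)) +
      (q2 * x2 * x2 * (p2) - p2 * (q2 * x2 * x2)) +
      (p2 * q2 * x2 * (x2) - x2 * (p2 * q2 * x2)) +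
      (p2 * x2 * (q2 * x2) - q2 * x2 * (p2 * x2)) +
      (x2 * (p2 * x2 * q2) - p2 * x2 * q2 * (x2)) +
      (q2 * x2 * x3 * (p3) - p3 * (q2 * x2 * x3)) +
      (p3 * q2 * x2 * (x3) - x3 * (p3 * q2 * x2)) +
      (p1 * x1 * (q3 * x3) - q3 * x3 * (p1 * x1)) +
      (q3 * x3 * x2 * (p2) - p2 * (q3 * x3 * x2)) +
      (p2 * q3 * x3 * (x2) - x2 * (p2 * q3 * x3)) +
      (q3 * x3 * x3 * (p3) - p3 * (q3 * x3 * x3)) +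
      (p3 * q3 * x3 * (x3) - x3 * (p3 * q3 * x3)) +
      (p3 * x3 * (q3 * x3) - q3 * x3 * (p3 * x3)) +
      (x3 * (p3 * x3 * q3) - p3 * x3 * q3 * (x3)) := by
  rw [← sub_eq_zero]
  trans (x1 * q1 - q2 * x2 - q3 * x3) *
      (x1 * p1 - p1 * x1 + (x2 * p2 - p2 * x2) + (x3 * p3 - p3 * x3)) +
    (p1 * x1 - x2 * p2 - x3 * p3) *
      (x1 * q1 - q1 * x1 + (x2 * q2 - q2 * x2) + (x3 * q3 - q3 * x3))
  · noncomm_ring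
  · rw [sp, sq]; simp

end ringlemmas

end Aux

end
noncomputable section

namespace Aux

variable {K : Type*} [Field K]

local notation "FA" => FreeAlgebra K (Fin 3)
local notation "x₀" => FreeAlgebra.ι K (0 : Fin 3)
local notation "x₁" => FreeAlgebra.ι K (1 : Fin 3)
local notation "x₂" => FreeAlgebra.ι K (2 : Fin 3)

/-- cyclic derivative -/
def C (i : Fin 3) (a : FA) : FA := E i a 1

/-- `X` is the Hamiltonian derivation attached to `a` -/
structure Form (X : FA →ₗ[K] FA) (a : FA) : Prop where
  der : IsDer X
  hx0 : X x₀ = x₀ * (x₁ * C 1 a) - C 2 a * x₂ * x₀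
  hx1 : X x₁ = x₁ * (C 2 a * x₂ - x₀ * C 0 a)
  hx2 : X x₂ = (C 0 a * x₀ - x₁ * C 1 a) * x₂

lemma tele1 (a : FA) :
    x₀ * C 0 a - C 0 a * x₀ + (x₁ * C 1 a - C 1 a * x₁) + (x₂ * C 2 a - C 2 a * x₂) = 0 := by
  have := tele a 1
  rw [Fin.sum_univ_three] at this
  simp only [C]
  rw [this]; simp

lemma skew {X Y : FA →ₗ[K] FA} {a b : FA} (hX : Form X a) (hY : Form Y b) :
    X b + Y a ∈ commutatorSpan K FA := by
  have red : ∀ (X : FA →ₗ[K] FA) (b : FA), IsDer X →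
      X b - ∑ k, C k b * X (FreeAlgebra.ι K k) ∈ commutatorSpan K FA := by
    intro X b h
    rw [der_eq h b, ← Finset.sum_sub_distrib]
    refine Submodule.sum_mem _ fun k _ => ?_
    simpa [C] using I_comm k (X (FreeAlgebra.ι K k)) b 1
  have hT : ∑ k, C k b * X (FreeAlgebra.ι K k) + ∑ k, C k a * Y (FreeAlgebra.ι K k) ∈
      commutatorSpan K FA := by
    rw [Fin.sum_univ_three, Fin.sum_univ_three, hX.hx0, hX.hx1, hX.hx2, hY.hx0, hY.hx1, hY.hx2,
      ring_skew _ _ _ _ _ _ _ _ _ (tele1 a) (tele1 b)]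
    iterate 31 refine Submodule.add_mem _ ?_ (comm_mem _ _)
    exact comm_mem _ _
  have := add_mem (add_mem (red X b hX.der) (red Y a hY.der)) hT
  convert this using 1
  abel

section ringlemmas

variable {R : Type*} [Ring R]

lemma ring_key0 (x0 x1 x2 q0 q1 q2 : R)
    (s : x0 * q0 - q0 * x0 + (x1 * q1 - q1 * x1) + (x2 * q2 - q2 * x2) = 0) :
    x0 * (q1 * x1 + q2 * x2 - x0 * q0) - (q1 * x1 + q2 * x2 - x0 * q0) * x0 =
      x0 * (x1 * q1) - q2 * x2 * x0 + (x0 * (x2 * q2) - q1 * (x1 * x0)) := by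
  rw [← sub_eq_zero]
  trans -(x0 * (x0 * q0 - q0 * x0 + (x1 * q1 - q1 * x1) + (x2 * q2 - q2 * x2)))
  · noncomm_ring
  · rw [s]; simp

lemma ring_key1 (x0 x1 x2 q0 q1 q2 : R)
    (s : x0 * q0 - q0 * x0 + (x1 * q1 - q1 * x1) + (x2 * q2 - q2 * x2) = 0) :
    x1 * (q1 * x1 + q2 * x2 - x0 * q0) - (q1 * x1 + q2 * x2 - x0 * q0) * x1 =
      x1 * (q2 * x2 - x0 * q0) + (q0 * (x0 * x1) - x2 * (q2 * x1)) := by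
  rw [← sub_eq_zero]
  trans (x0 * q0 - q0 * x0 + (x1 * q1 - q1 * x1) + (x2 * q2 - q2 * x2)) * x1
  · noncomm_ring
  · rw [s]; simp

lemma ring_key2 (x0 x1 x2 q0 q1 q2 : R)
    (s : x0 * q0 - q0 * x0 + (x1 * q1 - q1 * x1) + (x2 * q2 - q2 * x2) = 0) :
    x2 * (q1 * x1 + q2 * x2 - x0 * q0) - (q1 * x1 + q2 * x2 - x0 * q0) * x2 =
      (q0 * x0 - x1 * q1) * x2 + (x2 * (q1 * x1) - x2 * (x0 * q0)) := by
  rw [← sub_eq_zero]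
  trans (x0 * q0 - q0 * x0 + (x1 * q1 - q1 * x1) + (x2 * q2 - q2 * x2)) * x2
  · noncomm_ring
  · rw [s]; simp

end ringlemmas

lemma key {Y : FA →ₗ[K] FA} {b : FA} (hY : Form Y b) (w : FA) :
    I 0 w (x₀ * (x₂ * C 2 b)) - I 0 w (C 1 b * (x₁ * x₀))
      + (I 1 w (C 0 b * (x₀ * x₁)) - I 1 w (x₂ * (C 2 b * x₁)))
      + (I 2 w (x₂ * (C 1 b * x₁)) - I 2 w (x₂ * (x₀ * C 0 b))) =
    w * (C 1 b * x₁ + C 2 b * x₂ - x₀ * C 0 b) - (C 1 b * x₁ + C 2 b * x₂ - x₀ * C 0 b) * w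
      - Y w := by
  rw [← inn_apply, der_eq hY.der w, der_eq (inn_der _) w,
    Fin.sum_univ_three, Fin.sum_univ_three, inn_apply, inn_apply, inn_apply,
    ring_key0 _ _ _ _ _ _ (tele1 b), ring_key1 _ _ _ _ _ _ (tele1 b),
    ring_key2 _ _ _ _ _ _ (tele1 b), ← hY.hx0, ← hY.hx1, ← hY.hx2]
  simp only [I_add', I_sub']
  abel

lemma hessC (i k : Fin 3) (a h : FA) : E k (C i a) h = I i (C k a) h := hess1 i k a h

lemma C_der {X : FA →ₗ[K] FA} (hX : IsDer X) (i : Fin 3) (b : FA) :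
    C i (X b) = X (C i b) + (E i (X x₀) (C 0 b) + E i (X x₁) (C 1 b) + E i (X x₂) (C 2 b)) := by
  rw [C, E_der hX, hX.one, E_zero', Fin.sum_univ_three]
  simp [C]

lemma E0 {X Y : FA →ₗ[K] FA} {a b : FA} (hX : Form X a) (hY : Form Y b) :
    C 0 (X b) = X (C 0 b) - Y (C 0 a)
      + (C 0 a * (C 1 b * x₁ + C 2 b * x₂ - x₀ * C 0 b)
        - (C 1 b * x₁ + C 2 b * x₂ - x₀ * C 0 b) * C 0 a)
      + (x₁ * C 1 a * C 0 b - C 0 b * (C 2 a * x₂))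
      + (x₂ * C 2 b * C 0 a - C 0 a * (C 1 b * x₁)) := by
  have k := key hY (C 0 a)
  rw [C_der hX.der, hX.hx0, hX.hx1, hX.hx2]
  simp only [E_sub, E_mul, E_ι, hessC, sub_mul, mul_sub, mul_assoc] at k ⊢
  simp only [Fin.isValue, if_true, Fin.reduceEq, if_false, zero_ne_one, one_ne_zero]
  rw [eq_sub_iff_add_eq] at k
  rw [← sub_eq_zero] at k ⊢
  rw [← k]
  noncomm_ring

lemma E1 {X Y : FA →ₗ[K] FA} {a b : FA} (hX : Form X a) (hY : Form Y b) :
    C 1 (X b) = X (C 1 b) - Y (C 1 a)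
      + (C 1 a * (C 1 b * x₁ + C 2 b * x₂ - x₀ * C 0 b)
        - (C 1 b * x₁ + C 2 b * x₂ - x₀ * C 0 b) * C 1 a)
      + (C 2 a * x₂ - x₀ * C 0 a) * C 1 b
      + (C 1 a * (C 0 b * x₀) - C 1 a * (x₂ * C 2 b)) := by
  have k := key hY (C 1 a)
  rw [C_der hX.der, hX.hx0, hX.hx1, hX.hx2]
  simp only [E_sub, E_mul, E_ι, hessC, sub_mul, mul_sub, mul_assoc] at k ⊢
  simp only [Fin.isValue, if_true, Fin.reduceEq, if_false, zero_ne_one, one_ne_zero]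
  rw [eq_sub_iff_add_eq] at k
  rw [← sub_eq_zero] at k ⊢
  rw [← k]
  noncomm_ring

lemma E2 {X Y : FA →ₗ[K] FA} {a b : FA} (hX : Form X a) (hY : Form Y b) :
    C 2 (X b) = X (C 2 b) - Y (C 2 a)
      + (C 2 a * (C 1 b * x₁ + C 2 b * x₂ - x₀ * C 0 b)
        - (C 1 b * x₁ + C 2 b * x₂ - x₀ * C 0 b) * C 2 a)
      - C 2 b * (x₁ * C 1 a - C 0 a * x₀)
      + (C 1 b * x₁ * C 2 a - x₀ * C 0 b * C 2 a) := by
  have k := key hY (C 2 a)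
  rw [C_der hX.der, hX.hx0, hX.hx1, hX.hx2]
  simp only [E_sub, E_mul, E_ι, hessC, sub_mul, mul_sub, mul_assoc] at k ⊢
  simp only [Fin.isValue, if_true, Fin.reduceEq, if_false, zero_ne_one, one_ne_zero]
  rw [eq_sub_iff_add_eq] at k
  rw [← sub_eq_zero] at k ⊢
  rw [← k]
  noncomm_ring

lemma jacobi {X Y Z : FA →ₗ[K] FA} {a b : FA} (hX : Form X a) (hY : Form Y b)
    (hZ : Form Z (X b)) (c : FA) : X (Y c) - Y (X c) = Z c := by
  have hM : IsDer (X ∘ₗ Y - Y ∘ₗ X) := by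
    intro u v
    simp only [LinearMap.sub_apply, LinearMap.comp_apply, hX.der _ _, hY.der _ _, map_add]
    noncomm_ring
  have s := tele1 b
  refine der_ext hM hZ.der (fun k => ?_) c
  rw [LinearMap.sub_apply, LinearMap.comp_apply, LinearMap.comp_apply]
  fin_cases k
  · show X (Y x₀) - Y (X x₀) = Z x₀
    rw [hZ.hx0, hY.hx0, hX.hx0, E1 hX hY, E2 hX hY]
    simp only [map_sub, hX.der _ _, hY.der _ _, hX.hx0, hX.hx1, hX.hx2, hY.hx0, hY.hx1, hY.hx2]
    generalize C 0 a = p0 at *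
    generalize C 1 a = p1 at *
    generalize C 2 a = p2 at *
    generalize C 0 b = q0 at *
    generalize C 1 b = q1 at *
    generalize C 2 b = q2 at *
    rw [← sub_eq_zero]
    trans x₀ * x₁ * p1 * (x₀ * q0 - q0 * x₀ + (x₁ * q1 - q1 * x₁) + (x₂ * q2 - q2 * x₂)) -
      p2 * (x₀ * q0 - q0 * x₀ + (x₁ * q1 - q1 * x₁) + (x₂ * q2 - q2 * x₂)) * x₂ * x₀
    · noncomm_ring
    · rw [s]; simp
  · show X (Y x₁) - Y (X x₁) = Z x₁
    rw [hZ.hx1, hY.hx1, hX.hx1, E0 hX hY, E2 hX hY]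
    simp only [map_sub, hX.der _ _, hY.der _ _, hX.hx0, hX.hx1, hX.hx2, hY.hx0, hY.hx1, hY.hx2]
    generalize C 0 a = p0 at *
    generalize C 1 a = p1 at *
    generalize C 2 a = p2 at *
    generalize C 0 b = q0 at *
    generalize C 1 b = q1 at *
    generalize C 2 b = q2 at *
    rw [← sub_eq_zero]
    trans x₁ * p2 * (x₀ * q0 - q0 * x₀ + (x₁ * q1 - q1 * x₁) + (x₂ * q2 - q2 * x₂)) * x₂ +
      x₁ * x₀ * (x₀ * q0 - q0 * x₀ + (x₁ * q1 - q1 * x₁) + (x₂ * q2 - q2 * x₂)) * p0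
    · noncomm_ring
    · rw [s]; simp
  · show X (Y x₂) - Y (X x₂) = Z x₂
    rw [hZ.hx2, hY.hx2, hX.hx2, E0 hX hY, E1 hX hY]
    simp only [map_sub, hX.der _ _, hY.der _ _, hX.hx0, hX.hx1, hX.hx2, hY.hx0, hY.hx1, hY.hx2]
    generalize C 0 a = p0 at *
    generalize C 1 a = p1 at *
    generalize C 2 a = p2 at *
    generalize C 0 b = q0 at *
    generalize C 1 b = q1 at *
    generalize C 2 b = q2 at *
    rw [← sub_eq_zero]
    trans -(x₁ * p1 * (x₀ * q0 - q0 * x₀ + (x₁ * q1 - q1 * x₁) + (x₂ * q2 - q2 * x₂)) * x₂) -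
      (x₀ * q0 - q0 * x₀ + (x₁ * q1 - q1 * x₁) + (x₂ * q2 - q2 * x₂)) * p0 * x₀ * x₂
    · noncomm_ring
    · rw [s]; simp

end Aux

end

theorem stmt1 {K : Type*} [Field K] [IsAlgClosed K] [CharZero K]
    (D : FreeAlgebra K (Fin 3) ⊗[K] FreeAlgebra K (Fin 3) →ₗ[K] FreeAlgebra K (Fin 3) ⊗[K] FreeAlgebra K (Fin 3))
    (hL : LeibnizRules K (FreeAlgebra K (Fin 3)) D)
    (h11 : D (FreeAlgebra.ι K (0 : Fin 3) ⊗ₜ[K] FreeAlgebra.ι K (0 : Fin 3)) = 0)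
    (h22 : D (FreeAlgebra.ι K (1 : Fin 3) ⊗ₜ[K] FreeAlgebra.ι K (1 : Fin 3)) = 0)
    (h33 : D (FreeAlgebra.ι K (2 : Fin 3) ⊗ₜ[K] FreeAlgebra.ι K (2 : Fin 3)) = 0)
    (h12 : D (FreeAlgebra.ι K (0 : Fin 3) ⊗ₜ[K] FreeAlgebra.ι K (1 : Fin 3)) = -((FreeAlgebra.ι K (1 : Fin 3) * FreeAlgebra.ι K (0 : Fin 3)) ⊗ₜ[K] (1 : FreeAlgebra K (Fin 3))))
    (h21 : D (FreeAlgebra.ι K (1 : Fin 3) ⊗ₜ[K] FreeAlgebra.ι K (0 : Fin 3)) = (FreeAlgebra.ι K (0 : Fin 3) * FreeAlgebra.ι K (1 : Fin 3)) ⊗ₜ[K] (1 : FreeAlgebra K (Fin 3)))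
    (h23 : D (FreeAlgebra.ι K (1 : Fin 3) ⊗ₜ[K] FreeAlgebra.ι K (2 : Fin 3)) = -(FreeAlgebra.ι K (1 : Fin 3) ⊗ₜ[K] FreeAlgebra.ι K (2 : Fin 3)))
    (h32 : D (FreeAlgebra.ι K (2 : Fin 3) ⊗ₜ[K] FreeAlgebra.ι K (1 : Fin 3)) = FreeAlgebra.ι K (1 : Fin 3) ⊗ₜ[K] FreeAlgebra.ι K (2 : Fin 3))
    (h31 : D (FreeAlgebra.ι K (2 : Fin 3) ⊗ₜ[K] FreeAlgebra.ι K (0 : Fin 3)) = -((1 : FreeAlgebra K (Fin 3)) ⊗ₜ[K] (FreeAlgebra.ι K (2 : Fin 3) * FreeAlgebra.ι K (0 : Fin 3))))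
    (h13 : D (FreeAlgebra.ι K (0 : Fin 3) ⊗ₜ[K] FreeAlgebra.ι K (2 : Fin 3)) = (1 : FreeAlgebra K (Fin 3)) ⊗ₜ[K] (FreeAlgebra.ι K (0 : Fin 3) * FreeAlgebra.ι K (2 : Fin 3))) :
    IsModifiedDoublePoisson K (FreeAlgebra K (Fin 3)) D := by
  have hF : ∀ a, Aux.Form (Aux.ham D a) a := by
    intro a
    refine ⟨Aux.ham_der D hL a, ?_, ?_, ?_⟩
    · rw [← Aux.ham_apply, Aux.br_eq, Aux.mid_D D hL, Fin.sum_univ_three, h11, h21, h31]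
      simp only [map_zero, map_neg, Aux.mid_tmul, Aux.C]
      noncomm_ring
    · rw [← Aux.ham_apply, Aux.br_eq, Aux.mid_D D hL, Fin.sum_univ_three, h12, h22, h32]
      simp only [map_zero, map_neg, Aux.mid_tmul, Aux.C]
      noncomm_ring
    · rw [← Aux.ham_apply, Aux.br_eq, Aux.mid_D D hL, Fin.sum_univ_three, h13, h23, h33]
      simp only [map_zero, map_neg, Aux.mid_tmul, Aux.C]
      noncomm_ring
  refine ⟨hL, fun a b => ?_, fun a b c => ?_⟩
  · rw [Aux.ham_apply, Aux.ham_apply]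
    exact Aux.skew (hF a) (hF b)
  · simp only [Aux.ham_apply]
    rw [sub_eq_zero]
    exact Aux.jacobi (hF a) (hF b) (hF _) c
end

section
/- Let K be an algebraically closed field of characteristic zero and A = K⟨x1,x2,x3⟩ the free associative K-algebra. Every K-linear map ⟪-,-⟫ : A⊗A → A⊗A satisfying the Leibniz rules whose values on pairs of generators are ⟪x1,x2⟫ = −x1⊗x2, ⟪x2,x1⟫ = x1⊗x2, ⟪x2,x3⟫ = x3⊗x2, ⟪x3,x2⟫ = −x3⊗x2, ⟪x3,x1⟫ = x1⊗x3 − x3⊗x1, ⟪x1,x3⟫ = 0, and ⟪x_i,x_i⟫ = 0 for i = 1,2,3, is a modified double Poisson bracket on A. -/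
open TensorProduct

set_option linter.unusedSimpArgs false
set_option linter.unusedVariables false
set_option linter.unusedSectionVars false

namespace MDP

section

variable {K : Type*} [Field K] {A : Type*} [Ring A] [Algebra K A]

/-- middle insertion of 1 : `s ⊗ t ↦ s ⊗ 1 ⊗ t`. -/
noncomputable def o : A ⊗[K] A →ₗ[K] (A ⊗[K] A) ⊗[K] A := otimes1 K A 1

/-- `s ⊗ t ↦ 1 ⊗ s ⊗ t`. -/
noncomputable def e : A ⊗[K] A →ₐ[K] (A ⊗[K] A) ⊗[K] A :=
  Algebra.TensorProduct.map Algebra.TensorProduct.includeRight (AlgHom.id K A)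

/-- the flip as an algebra map. -/
noncomputable def fl : A ⊗[K] A →ₐ[K] A ⊗[K] A := (Algebra.TensorProduct.comm K A A).toAlgHom

noncomputable def m12 : (A ⊗[K] A) ⊗[K] A →ₗ[K] A ⊗[K] A :=
  LinearMap.rTensor A (LinearMap.mul' K A)

noncomputable def m23 : (A ⊗[K] A) ⊗[K] A →ₗ[K] A ⊗[K] A :=
  LinearMap.lTensor A (LinearMap.mul' K A) ∘ₗ (TensorProduct.assoc K A A A).toLinearMap

@[simp] lemma o_tmul (x y : A) : o (K := K) (x ⊗ₜ y) = (x ⊗ₜ 1) ⊗ₜ y := by simp [o, otimes1]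
@[simp] lemma e_tmul (x y : A) : e (K := K) (x ⊗ₜ y) = (1 ⊗ₜ x) ⊗ₜ y := by simp [e]
@[simp] lemma fl_tmul (x y : A) : fl (K := K) (x ⊗ₜ y) = y ⊗ₜ x := by simp [fl]
@[simp] lemma m12_tmul (x y z : A) : m12 (K := K) ((x ⊗ₜ y) ⊗ₜ z) = (x * y) ⊗ₜ z := by simp [m12]
@[simp] lemma m23_tmul (x y z : A) : m23 (K := K) ((x ⊗ₜ y) ⊗ₜ z) = x ⊗ₜ (y * z) := by simp [m23]
@[simp] lemma swap23_tmul (x y z : A) : swap23 K A ((x ⊗ₜ y) ⊗ₜ z) = (x ⊗ₜ z) ⊗ₜ y := by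
  simp [swap23]

lemma fl_fl (t : A ⊗[K] A) : fl (fl t) = t := by
  induction t using TensorProduct.induction_on with
  | zero => simp
  | tmul u v => simp
  | add x y hx hy => simp only [map_add, hx, hy]

variable (D : A ⊗[K] A →ₗ[K] A ⊗[K] A)

@[simp] lemma dL_tmul (a u v : A) : dL K A D a (u ⊗ₜ v) = D (a ⊗ₜ u) ⊗ₜ v := by simp [dL]
@[simp] lemma dR_tmul (a u v : A) : dR K A D a (u ⊗ₜ v) =
    (TensorProduct.assoc K A A A).symm (u ⊗ₜ D (a ⊗ₜ v)) := by simp [dR]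
@[simp] lemma dLfst_tmul (c u v : A) : dLfst K A D c (u ⊗ₜ v) =
    swap23 K A (D (u ⊗ₜ c) ⊗ₜ v) := by simp [dLfst]

/-- `{a, -}`. -/
noncomputable def del (a : A) : A →ₗ[K] A := LinearMap.mul' K A ∘ₗ D ∘ₗ TensorProduct.mk K A A a

lemma del_apply (a b : A) : del D a b = br K A D a b := rfl

noncomputable def act (a : A) : A ⊗[K] A →ₗ[K] A ⊗[K] A :=
  LinearMap.rTensor A (del D a) + LinearMap.lTensor A (del D a)

@[simp] lemma act_tmul (a u v : A) : act D a (u ⊗ₜ v) = del D a u ⊗ₜ v + u ⊗ₜ del D a v := by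
  simp [act]

/-- Skewness defect. -/
noncomputable def EE (a b : A) : A ⊗[K] A := D (a ⊗ₜ b) + fl (D (b ⊗ₜ a))

/-- Lie derivative of the double bracket. -/
noncomputable def PP (a b c : A) : A ⊗[K] A :=
  act D a (D (b ⊗ₜ c)) - D (b ⊗ₜ del D a c) - D (del D a b ⊗ₜ c)

lemma m_l (b : A) (t : A ⊗[K] A) : LinearMap.mul' K A ((b ⊗ₜ 1) * t) = b * LinearMap.mul' K A t := by
  induction t using TensorProduct.induction_on with
  | zero => simp
  | tmul u v => simp [mul_assoc]
  | add x y hx hy => simp only [map_add, add_mul, mul_add, add_tmul, tmul_add, hx, hy]; try abel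

lemma m_r (b : A) (t : A ⊗[K] A) : LinearMap.mul' K A (t * (1 ⊗ₜ b)) = LinearMap.mul' K A t * b := by
  induction t using TensorProduct.induction_on with
  | zero => simp
  | tmul u v => simp [mul_assoc]
  | add x y hx hy => simp only [map_add, add_mul, mul_add, add_tmul, tmul_add, hx, hy]; try abel

lemma m_in (b : A) (t : A ⊗[K] A) : LinearMap.mul' K A (t * (b ⊗ₜ 1)) = LinearMap.mul' K A ((1 ⊗ₜ b) * t) := by
  induction t using TensorProduct.induction_on with
  | zero => simp
  | tmul u v => simp [mul_assoc]
  | add x y hx hy => simp only [map_add, add_mul, mul_add, add_tmul, tmul_add, hx, hy]; try abel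

lemma o_l (b : A) (t : A ⊗[K] A) : o ((1 ⊗ₜ b) * t) = ((1 : A ⊗[K] A) ⊗ₜ b) * o t := by
  induction t using TensorProduct.induction_on with
  | zero => simp
  | tmul u v => simp [Algebra.TensorProduct.one_def]
  | add x y hx hy => simp only [map_add, add_mul, mul_add, add_tmul, tmul_add, hx, hy]; try abel

lemma o_r (b : A) (t : A ⊗[K] A) : o (t * (b ⊗ₜ 1)) = o t * ((b ⊗ₜ 1) ⊗ₜ 1) := by
  induction t using TensorProduct.induction_on with
  | zero => simp
  | tmul u v => simp
  | add x y hx hy => simp only [map_add, add_mul, mul_add, add_tmul, tmul_add, hx, hy]; try abel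

lemma o_comm (b : A) (t : A ⊗[K] A) : ((1 ⊗ₜ b) ⊗ₜ 1) * o t = o t * ((1 ⊗ₜ b) ⊗ₜ 1) := by
  induction t using TensorProduct.induction_on with
  | zero => simp
  | tmul u v => simp
  | add x y hx hy => simp only [map_add, add_mul, mul_add, add_tmul, tmul_add, hx, hy]; try abel

lemma as_aux (x y z : A) (t : A ⊗[K] A) : (TensorProduct.assoc K A A A).symm ((x * y) ⊗ₜ (t * z ⊗ₜ 1)) =
    (TensorProduct.assoc K A A A).symm (x ⊗ₜ t) * ((y ⊗ₜ z) ⊗ₜ 1) := by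
  induction t using TensorProduct.induction_on with
  | zero => simp
  | tmul u v => simp
  | add x y hx hy => simp only [map_add, add_mul, mul_add, add_tmul, tmul_add, hx, hy]; try abel

lemma as_r3 (x z : A) (t : A ⊗[K] A) : (TensorProduct.assoc K A A A).symm (x ⊗ₜ (t * 1 ⊗ₜ z)) =
    (TensorProduct.assoc K A A A).symm (1 ⊗ₜ t) * ((x ⊗ₜ 1) ⊗ₜ z) := by
  induction t using TensorProduct.induction_on with
  | zero => simp
  | tmul u v => simp
  | add x y hx hy => simp only [map_add, add_mul, mul_add, add_tmul, tmul_add, hx, hy]; try abel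

lemma as_e (t : A ⊗[K] A) : (TensorProduct.assoc K A A A).symm (1 ⊗ₜ t) = e t := by
  induction t using TensorProduct.induction_on with
  | zero => simp
  | tmul u v => simp
  | add x y hx hy => simp only [map_add, add_mul, mul_add, add_tmul, tmul_add, hx, hy]; try abel

lemma as_l (x y z : A) (t : A ⊗[K] A) : (TensorProduct.assoc K A A A).symm (x ⊗ₜ ((y ⊗ₜ z) * t)) =
    ((1 ⊗ₜ y) ⊗ₜ z) * (TensorProduct.assoc K A A A).symm (x ⊗ₜ t) := by
  induction t using TensorProduct.induction_on with
  | zero => simp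
  | tmul u v => simp
  | add x y hx hy => simp only [map_add, add_mul, mul_add, add_tmul, tmul_add, hx, hy]; try abel

lemma sw_l (x y z : A) (t : A ⊗[K] A) : swap23 K A (((1 ⊗ₜ x) * t) ⊗ₜ (y * z)) =
    ((1 ⊗ₜ y) ⊗ₜ x) * swap23 K A (t ⊗ₜ z) := by
  induction t using TensorProduct.induction_on with
  | zero => simp
  | tmul u v => simp
  | add x y hx hy => simp only [map_add, add_mul, mul_add, add_tmul, tmul_add, hx, hy]; try abel

lemma sw_r (x y z : A) (t : A ⊗[K] A) : swap23 K A ((t * (x ⊗ₜ 1)) ⊗ₜ (y * z)) =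
    swap23 K A (t ⊗ₜ y) * ((x ⊗ₜ z) ⊗ₜ 1) := by
  induction t using TensorProduct.induction_on with
  | zero => simp
  | tmul u v => simp
  | add x y hx hy => simp only [map_add, add_mul, mul_add, add_tmul, tmul_add, hx, hy]; try abel

lemma sw_o (t : A ⊗[K] A) : swap23 K A (t ⊗ₜ 1) = o t := by
  induction t using TensorProduct.induction_on with
  | zero => simp
  | tmul u v => simp
  | add x y hx hy => simp only [map_add, add_mul, mul_add, add_tmul, tmul_add, hx, hy]; try abel


section L
variable {D}

lemma D_one_r (hL : LeibnizRules K A D) (a : A) : D (a ⊗ₜ 1) = 0 := by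
  have := hL.1 a 1 1
  rw [mul_one, ← Algebra.TensorProduct.one_def, one_mul, mul_one] at this
  simpa using this

lemma D_one_l (hL : LeibnizRules K A D) (a : A) : D (1 ⊗ₜ a) = 0 := by
  have := hL.2 1 1 a
  rw [mul_one, ← Algebra.TensorProduct.one_def, one_mul, mul_one] at this
  simpa using this

lemma D_alg_r (hL : LeibnizRules K A D) (a : A) (r : K) : D (a ⊗ₜ algebraMap K A r) = 0 := by
  rw [Algebra.algebraMap_eq_smul_one, tmul_smul, map_smul, D_one_r hL, smul_zero]

lemma D_alg_l (hL : LeibnizRules K A D) (a : A) (r : K) : D (algebraMap K A r ⊗ₜ a) = 0 := by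
  rw [Algebra.algebraMap_eq_smul_one, ← smul_tmul', map_smul, D_one_l hL, smul_zero]

lemma del_mul (hL : LeibnizRules K A D) (a b c : A) : del D a (b * c) = b * del D a c + del D a b * c := by
  simp only [del, LinearMap.comp_apply, TensorProduct.mk_apply, hL.1, map_add, m_l, m_r]

lemma E_mul_r (hL : LeibnizRules K A D) (a b c : A) : EE D a (b * c) = (b ⊗ₜ 1) * EE D a c + EE D a b * (1 ⊗ₜ c) := by
  simp only [EE, hL.1, hL.2, map_add, map_mul, fl_tmul, mul_add, add_mul]; abel

lemma E_mul_l (hL : LeibnizRules K A D) (a b c : A) : EE D (a * b) c = (1 ⊗ₜ a) * EE D b c + EE D a c * (b ⊗ₜ 1) := by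
  simp only [EE, hL.1, hL.2, map_add, map_mul, fl_tmul, mul_add, add_mul]; abel

lemma i1 (hL : LeibnizRules K A D) (a x : A) (t : A ⊗[K] A) : dL K A D a ((1 ⊗ₜ x) * t) =
    ((1 : A ⊗[K] A) ⊗ₜ x) * dL K A D a t := by
  induction t using TensorProduct.induction_on with
  | zero => simp
  | tmul u v => simp
  | add x y hx hy => simp only [map_add, add_mul, mul_add, add_tmul, tmul_add, hx, hy]; try abel

lemma i2 (hL : LeibnizRules K A D) (a y : A) (t : A ⊗[K] A) : dL K A D a (t * (y ⊗ₜ 1)) =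
    dL K A D a t * ((1 ⊗ₜ y) ⊗ₜ 1) + o t * (D (a ⊗ₜ y) ⊗ₜ 1) := by
  induction t using TensorProduct.induction_on with
  | zero => simp
  | tmul u v =>
    simp only [Algebra.TensorProduct.tmul_mul_tmul, dL_tmul, mul_one, hL.1, o_tmul, add_tmul]; abel
  | add x y hx hy => simp only [map_add, add_mul, mul_add, add_tmul, tmul_add, hx, hy]; try abel

lemma i3 (hL : LeibnizRules K A D) (c y : A) (t : A ⊗[K] A) : dLfst K A D c ((y ⊗ₜ 1) * t) =
    ((1 : A ⊗[K] A) ⊗ₜ y) * dLfst K A D c t + o (D (y ⊗ₜ c)) * (t ⊗ₜ 1) := by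
  induction t using TensorProduct.induction_on with
  | zero => simp
  | tmul u v =>
    have h1 := sw_l y 1 v (D (u ⊗ₜ[K] c))
    have h2 := sw_r u 1 v (D (y ⊗ₜ[K] c))
    rw [one_mul] at h1 h2
    simp only [Algebra.TensorProduct.tmul_mul_tmul, dLfst_tmul, one_mul, hL.2, add_tmul, map_add, h1, h2, sw_o, Algebra.TensorProduct.one_def]
  | add x y hx hy => simp only [map_add, add_mul, mul_add, add_tmul, tmul_add, hx, hy]; try abel

lemma i4 (hL : LeibnizRules K A D) (c y : A) (t : A ⊗[K] A) : dLfst K A D c (t * (1 ⊗ₜ y)) =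
    dLfst K A D c t * ((1 ⊗ₜ y) ⊗ₜ 1) := by
  induction t using TensorProduct.induction_on with
  | zero => simp
  | tmul u v =>
    have h2 := sw_r 1 v y (D (u ⊗ₜ[K] c))
    rw [← Algebra.TensorProduct.one_def, mul_one] at h2
    simp only [Algebra.TensorProduct.tmul_mul_tmul, dLfst_tmul, mul_one, h2]
  | add x y hx hy => simp only [map_add, add_mul, mul_add, add_tmul, tmul_add, hx, hy]; try abel

lemma i5 (hL : LeibnizRules K A D) (a b : A) (t : A ⊗[K] A) : dR K A D (a * b) t =
    ((1 : A ⊗[K] A) ⊗ₜ a) * dR K A D b t + dR K A D a t * ((1 ⊗ₜ b) ⊗ₜ 1) := by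
  induction t using TensorProduct.induction_on with
  | zero => simp
  | tmul u v =>
    have h := as_aux u 1 b (D (a ⊗ₜ[K] v))
    rw [mul_one] at h
    simp only [dR_tmul, hL.2, tmul_add, map_add, as_l, h, Algebra.TensorProduct.one_def]
  | add x y hx hy => simp only [map_add, add_mul, mul_add, add_tmul, tmul_add, hx, hy]; try abel

lemma i6 (hL : LeibnizRules K A D) (a b : A) (t : A ⊗[K] A) : dL K A D (a * b) t =
    ((1 ⊗ₜ a) ⊗ₜ 1) * dL K A D b t + dL K A D a t * ((b ⊗ₜ 1) ⊗ₜ 1) := by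
  induction t using TensorProduct.induction_on with
  | zero => simp
  | tmul u v =>
    simp only [dL_tmul, hL.2, add_tmul, Algebra.TensorProduct.tmul_mul_tmul, one_mul, mul_one]
  | add x y hx hy => simp only [map_add, add_mul, mul_add, add_tmul, tmul_add, hx, hy]; try abel

lemma i7 (hL : LeibnizRules K A D) (b a : A) (t : A ⊗[K] A) : dR K A D b ((1 ⊗ₜ a) * t) =
    ((1 ⊗ₜ a) ⊗ₜ 1) * dR K A D b t + e (D (b ⊗ₜ a)) * o t := by
  induction t using TensorProduct.induction_on with
  | zero => simp
  | tmul u v =>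
    simp only [Algebra.TensorProduct.tmul_mul_tmul, dR_tmul, one_mul, hL.1, tmul_add, map_add, as_l, as_r3, as_e, o_tmul]
  | add x y hx hy => simp only [map_add, add_mul, mul_add, add_tmul, tmul_add, hx, hy]; try abel

lemma i8 (hL : LeibnizRules K A D) (b a : A) (t : A ⊗[K] A) : dR K A D b (t * (a ⊗ₜ 1)) =
    dR K A D b t * ((a ⊗ₜ 1) ⊗ₜ 1) := by
  induction t using TensorProduct.induction_on with
  | zero => simp
  | tmul u v =>
    have h := as_aux u a 1 (D (b ⊗ₜ[K] v))
    rw [← Algebra.TensorProduct.one_def, mul_one] at h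
    simp only [Algebra.TensorProduct.tmul_mul_tmul, dR_tmul, mul_one, h]
  | add x y hx hy => simp only [map_add, add_mul, mul_add, add_tmul, tmul_add, hx, hy]; try abel

lemma i9 (hL : LeibnizRules K A D) (c a : A) (t : A ⊗[K] A) : dLfst K A D c ((1 ⊗ₜ a) * t) =
    ((1 ⊗ₜ a) ⊗ₜ 1) * dLfst K A D c t := by
  induction t using TensorProduct.induction_on with
  | zero => simp
  | tmul u v =>
    have h1 := sw_l 1 a v (D (u ⊗ₜ[K] c))
    rw [← Algebra.TensorProduct.one_def, one_mul] at h1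
    simp only [Algebra.TensorProduct.tmul_mul_tmul, dLfst_tmul, one_mul, h1]
  | add x y hx hy => simp only [map_add, add_mul, mul_add, add_tmul, tmul_add, hx, hy]; try abel

lemma i10 (hL : LeibnizRules K A D) (c a : A) (t : A ⊗[K] A) : dLfst K A D c (t * (a ⊗ₜ 1)) =
    dLfst K A D c t * ((a ⊗ₜ 1) ⊗ₜ 1) + e (fl t) * o (D (a ⊗ₜ c)) := by
  induction t using TensorProduct.induction_on with
  | zero => simp
  | tmul u v =>
    have h2 := sw_r a v 1 (D (u ⊗ₜ[K] c))
    have h1 := sw_l u v 1 (D (a ⊗ₜ[K] c))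
    rw [mul_one] at h1 h2
    simp only [Algebra.TensorProduct.tmul_mul_tmul, dLfst_tmul, mul_one, hL.2, add_tmul, map_add, h1, h2, sw_o, fl_tmul, e_tmul]
    abel
  | add x y hx hy => simp only [map_add, add_mul, mul_add, add_tmul, tmul_add, hx, hy]; try abel


lemma DJac_mul_b (hL : LeibnizRules K A D) (a b b' c : A) : DJac K A D a (b * b') c =
    ((1 : A ⊗[K] A) ⊗ₜ b) * DJac K A D a b' c + DJac K A D a b c * ((1 ⊗ₜ b') ⊗ₜ 1) := by
  simp only [DJac, hL.1 a b b', hL.2 b b' c, map_add, i1 hL, i2 hL, i3 hL, i4 hL, i5 hL, mul_sub, sub_mul]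
  abel

lemma DJac_mul_a (hL : LeibnizRules K A D) (a a' b c : A) : DJac K A D (a * a') b c =
    ((1 ⊗ₜ a) ⊗ₜ 1) * DJac K A D a' b c + DJac K A D a b c * ((a' ⊗ₜ 1) ⊗ₜ 1)
      - e (EE D b a) * o (D (a' ⊗ₜ c)) := by
  simp only [DJac, EE, hL.2 a a' b, hL.2 a a' c, map_add, i6 hL, i7 hL, i8 hL, i9 hL, i10 hL, mul_sub, sub_mul, add_mul]
  abel

lemma q1a (x : A) (t : A ⊗[K] A) : m12 ((TensorProduct.assoc K A A A).symm (x ⊗ₜ t)) = (x ⊗ₜ 1) * t := by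
  induction t using TensorProduct.induction_on with
  | zero => simp
  | tmul u v => simp
  | add x y hx hy => simp only [map_add, add_mul, mul_add, add_tmul, tmul_add, hx, hy]; try abel
lemma q1b (x : A) (t : A ⊗[K] A) : m23 (t ⊗ₜ x) = t * (1 ⊗ₜ x) := by
  induction t using TensorProduct.induction_on with
  | zero => simp
  | tmul u v => simp
  | add x y hx hy => simp only [map_add, add_mul, mul_add, add_tmul, tmul_add, hx, hy]; try abel
lemma q1c (x : A) (t : A ⊗[K] A) : m23 (swap23 K A (t ⊗ₜ x)) = (1 ⊗ₜ x) * t := by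
  induction t using TensorProduct.induction_on with
  | zero => simp
  | tmul u v => simp
  | add x y hx hy => simp only [map_add, add_mul, mul_add, add_tmul, tmul_add, hx, hy]; try abel
lemma q1d (x : A) (t : A ⊗[K] A) : m12 (swap23 K A (t ⊗ₜ x)) = t * (x ⊗ₜ 1) := by
  induction t using TensorProduct.induction_on with
  | zero => simp
  | tmul u v => simp
  | add x y hx hy => simp only [map_add, add_mul, mul_add, add_tmul, tmul_add, hx, hy]; try abel
lemma q1e (x : A) (t : A ⊗[K] A) : m12 (t ⊗ₜ x) = LinearMap.mul' K A t ⊗ₜ x := by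
  induction t using TensorProduct.induction_on with
  | zero => simp
  | tmul u v => simp
  | add x y hx hy => simp only [map_add, add_mul, mul_add, add_tmul, tmul_add, hx, hy]; try abel
lemma q1f (x : A) (t : A ⊗[K] A) : m23 ((TensorProduct.assoc K A A A).symm (x ⊗ₜ t)) = x ⊗ₜ LinearMap.mul' K A t := by
  induction t using TensorProduct.induction_on with
  | zero => simp
  | tmul u v => simp
  | add x y hx hy => simp only [map_add, add_mul, mul_add, add_tmul, tmul_add, hx, hy]; try abel
lemma q1 (hL : LeibnizRules K A D) (b : A) (t : A ⊗[K] A) : D (b ⊗ₜ LinearMap.mul' K A t) =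
    m12 (dR K A D b t) + m23 (dL K A D b t) := by
  induction t using TensorProduct.induction_on with
  | zero => simp
  | tmul u v =>
    rw [LinearMap.mul'_apply, hL.1, dR_tmul, dL_tmul, q1a, q1b]
  | add x y hx hy => simp only [map_add, add_mul, mul_add, add_tmul, tmul_add, hx, hy]; try abel

lemma q2 (hL : LeibnizRules K A D) (c : A) (t : A ⊗[K] A) : D (LinearMap.mul' K A t ⊗ₜ c) =
    m12 (dLfst K A D c t) + m23 (dLfst K A D c (fl t)) := by
  induction t using TensorProduct.induction_on with
  | zero => simp
  | tmul u v =>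
    rw [LinearMap.mul'_apply, hL.2, fl_tmul, dLfst_tmul, dLfst_tmul, q1c, q1d, add_comm]
  | add x y hx hy => simp only [map_add, add_mul, mul_add, add_tmul, tmul_add, hx, hy]; try abel

lemma q3 (hL : LeibnizRules K A D) (a : A) (t : A ⊗[K] A) : act D a t =
    m12 (dL K A D a t) + m23 (dR K A D a t) := by
  induction t using TensorProduct.induction_on with
  | zero => simp
  | tmul u v =>
    rw [act_tmul, dL_tmul, dR_tmul, q1e, q1f]; rfl
  | add x y hx hy => simp only [map_add, add_mul, mul_add, add_tmul, tmul_add, hx, hy]; try abel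


lemma PP_eq (hL : LeibnizRules K A D) (a b c : A) : PP D a b c = m12 (DJac K A D a b c) - m23 (DJac K A D b a c)
    - m23 (dLfst K A D c (EE D b a)) := by
  have h1 := q1 hL b (D (a ⊗ₜ c))
  have h2 := q2 hL c (D (a ⊗ₜ b))
  have h3 := q3 hL a (D (b ⊗ₜ c))
  simp only [PP, h3, DJac, EE, map_sub, map_add]
  change _ - D (b ⊗ₜ LinearMap.mul' K A (D (a ⊗ₜ c))) - D (LinearMap.mul' K A (D (a ⊗ₜ b)) ⊗ₜ c) = _
  rw [h1, h2]
  abel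

lemma act_l (hL : LeibnizRules K A D) (a b : A) (t : A ⊗[K] A) : act D a ((1 ⊗ₜ b) * t) =
    (1 ⊗ₜ b) * act D a t + (1 ⊗ₜ del D a b) * t := by
  induction t using TensorProduct.induction_on with
  | zero => simp
  | tmul u v =>
    simp only [Algebra.TensorProduct.tmul_mul_tmul, act_tmul, one_mul, del_mul hL, tmul_add, mul_add]; abel
  | add x y hx hy => simp only [map_add, add_mul, mul_add, add_tmul, tmul_add, hx, hy]; try abel

lemma act_r (hL : LeibnizRules K A D) (a b : A) (t : A ⊗[K] A) : act D a (t * (b ⊗ₜ 1)) =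
    act D a t * (b ⊗ₜ 1) + t * (del D a b ⊗ₜ 1) := by
  induction t using TensorProduct.induction_on with
  | zero => simp
  | tmul u v =>
    simp only [Algebra.TensorProduct.tmul_mul_tmul, act_tmul, mul_one, del_mul hL, add_tmul, add_mul]; abel
  | add x y hx hy => simp only [map_add, add_mul, mul_add, add_tmul, tmul_add, hx, hy]; try abel


lemma PP_mul (hL : LeibnizRules K A D) (a b b' c : A) : PP D a (b * b') c =
    (1 ⊗ₜ b) * PP D a b' c + PP D a b c * (b' ⊗ₜ 1) := by
  simp only [PP, hL.2, del_mul hL, add_tmul, map_add, act_l hL, act_r hL, mul_sub, sub_mul]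
  abel

lemma G_r (hL : LeibnizRules K A D) (c y : A) (t : A ⊗[K] A) : m23 (dLfst K A D c (t * (y ⊗ₜ 1))) =
    (1 ⊗ₜ LinearMap.mul' K A (fl t)) * D (y ⊗ₜ c) + m23 (dLfst K A D c t) * (y ⊗ₜ 1) := by
  induction t using TensorProduct.induction_on with
  | zero => simp
  | tmul u v =>
    simp only [Algebra.TensorProduct.tmul_mul_tmul, dLfst_tmul, mul_one, q1c, hL.2, mul_add, ← mul_assoc, fl_tmul, LinearMap.mul'_apply]
  | add x y hx hy => simp only [map_add, add_mul, mul_add, add_tmul, tmul_add, hx, hy]; try abel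

lemma G_l (hL : LeibnizRules K A D) (c y : A) (t : A ⊗[K] A) : m23 (dLfst K A D c ((1 ⊗ₜ y) * t)) =
    (1 ⊗ₜ y) * m23 (dLfst K A D c t) := by
  induction t using TensorProduct.induction_on with
  | zero => simp
  | tmul u v =>
    simp only [Algebra.TensorProduct.tmul_mul_tmul, dLfst_tmul, one_mul, q1c, ← mul_assoc]
  | add x y hx hy => simp only [map_add, add_mul, mul_add, add_tmul, tmul_add, hx, hy]; try abel

end L

lemma m12_r (y : A) (t : (A ⊗[K] A) ⊗[K] A) : m12 (t * ((1 ⊗ₜ y) ⊗ₜ 1)) = m12 t * (y ⊗ₜ 1) := by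
  induction t using TensorProduct.induction_on with
  | zero => simp
  | tmul u v =>
    induction u using TensorProduct.induction_on with
    | zero => simp
    | tmul u w => simp [mul_assoc]
    | add x y hx hy => simp only [map_add, add_mul, add_tmul, hx, hy]
  | add x y hx hy => simp only [map_add, add_mul, mul_add, add_tmul, tmul_add, hx, hy]; try abel

lemma m12_l (y : A) (t : (A ⊗[K] A) ⊗[K] A) : m12 ((1 ⊗ₜ y) * t) = (1 ⊗ₜ y) * m12 t := by
  induction t using TensorProduct.induction_on with
  | zero => simp
  | tmul u v =>
    induction u using TensorProduct.induction_on with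
    | zero => simp
    | tmul u w => simp
    | add x y hx hy => simp only [map_add, mul_add, add_tmul, hx, hy]
  | add x y hx hy => simp only [map_add, add_mul, mul_add, add_tmul, tmul_add, hx, hy]; try abel

lemma m12_o (y : A) (t : A ⊗[K] A) : m12 (((1 ⊗ₜ y) ⊗ₜ 1) * o t) = t * (y ⊗ₜ 1) := by
  induction t using TensorProduct.induction_on with
  | zero => simp
  | tmul u v => simp
  | add x y hx hy => simp only [map_add, add_mul, mul_add, add_tmul, tmul_add, hx, hy]; try abel

lemma m23_eo (X t : A ⊗[K] A) : m23 (e X * o t) = (1 ⊗ₜ LinearMap.mul' K A X) * t := by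
  induction t using TensorProduct.induction_on with
  | zero => simp
  | add x y hx hy => simp only [map_add, mul_add, hx, hy]
  | tmul p q =>
    induction X using TensorProduct.induction_on with
    | zero => simp
    | tmul u w => simp [mul_assoc]
    | add x y hx hy => simp only [map_add, add_mul, tmul_add, hx, hy]


lemma DJac_add_a (a a' b c : A) : DJac K A D (a + a') b c = DJac K A D a b c + DJac K A D a' b c := by
  simp only [DJac, dL, map_add, add_tmul, LinearMap.comp_add, LinearMap.rTensor_add, LinearMap.add_apply]
  abel

lemma DJac_add_b (a b b' c : A) : DJac K A D a (b + b') c = DJac K A D a b c + DJac K A D a b' c := by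
  simp only [DJac, dR, map_add, add_tmul, tmul_add, LinearMap.comp_add, LinearMap.lTensor_add, LinearMap.add_apply]
  abel

lemma DJac_alg_a (hL : LeibnizRules K A D) (r : K) (b c : A) : DJac K A D (algebraMap K A r) b c = 0 := by
  have : D ∘ₗ TensorProduct.mk K A A (algebraMap K A r) = 0 := by
    ext x; simp [D_alg_l hL]
  simp [DJac, dL, this, D_alg_l hL]

lemma DJac_alg_b (hL : LeibnizRules K A D) (r : K) (a c : A) : DJac K A D a (algebraMap K A r) c = 0 := by
  have : D ∘ₗ TensorProduct.mk K A A (algebraMap K A r) = 0 := by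
    ext x; simp [D_alg_l hL]
  simp [DJac, dR, this, D_alg_l hL, D_alg_r hL]

end


section FF
variable {K : Type*} [Field K] {I : Type*} {F : Type*} [Ring F] [Algebra K F] (x : I → F)

/-- Induction principle: `x` generates `F`. -/
def Ind (K : Type*) [Field K] {I : Type*} {F : Type*} [Ring F] [Algebra K F] (x : I → F) : Prop :=
  ∀ {motive : F → Prop} (grade0 : ∀ r : K, motive (algebraMap K F r)) (grade1 : ∀ i, motive (x i))
    (mul : ∀ a b, motive a → motive b → motive (a * b))
    (add : ∀ a b, motive a → motive b → motive (a + b)) (a : F), motive a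

lemma Ind.induction {x : I → F} (h : Ind K x) {motive : F → Prop}
    (grade0 : ∀ r : K, motive (algebraMap K F r)) (grade1 : ∀ i, motive (x i))
    (mul : ∀ a b, motive a → motive b → motive (a * b))
    (add : ∀ a b, motive a → motive b → motive (a + b)) (a : F) : motive a :=
  h grade0 grade1 mul add a

lemma nn2 (P Q : (F ⊗[K] F) ⊗[K] F) : @Neg.neg _ TensorProduct.neg Q * P = @Neg.neg _ TensorProduct.neg (Q * P) := by
  have h : @Neg.neg _ TensorProduct.neg Q * P + Q * P = 0 := by
    rw [← add_mul]
    have : @Neg.neg _ TensorProduct.neg Q + Q = 0 := neg_add_cancel Q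
    rw [this, zero_mul]
  exact eq_neg_of_add_eq_zero_left h

/-- Key structure. -/
def Key (D : F ⊗[K] F →ₗ[K] F ⊗[K] F) (a : F) : Prop :=
  ∃ X : F ⊗[K] F, (∀ j, EE D a (x j) = -(X * (1 ⊗ₜ x j)) + (x j ⊗ₜ 1) * X + 1 ⊗ₜ (a * x j) - (x j * a) ⊗ₜ 1) ∧
    (∀ j k, DJac K F D (x j) a (x k) = e (X - 1 ⊗ₜ a) * o (D (x j ⊗ₜ x k))) ∧
    (∀ k, ∃ Z : (F ⊗[K] F) ⊗[K] F, ∀ j, DJac K F D a (x j) (x k) =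
      ((1 ⊗ₜ x j) ⊗ₜ 1) * o (D (a ⊗ₜ x k)) + Z * ((1 ⊗ₜ x j) ⊗ₜ 1) - (1 ⊗ₜ x j) * Z)

lemma key_all (D : F ⊗[K] F →ₗ[K] F ⊗[K] F) (hL : LeibnizRules K F D) (hI : Ind K x)
    (hE : ∀ i j, EE D (x i) (x j) = x j ⊗ₜ x i - x i ⊗ₜ x j)
    (hJ : ∀ i j k, DJac K F D (x i) (x j) (x k) = ((1 ⊗ₜ x j) ⊗ₜ 1) * o (D (x i ⊗ₜ x k)))
    (a : F) : Key x D a := by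
  induction a using hI.induction with
  | grade0 r =>
    refine ⟨1 ⊗ₜ algebraMap K F r, fun j => ?_, fun j k => ?_, fun k => ⟨0, fun j => ?_⟩⟩
    · have h : (1 : F) ⊗ₜ[K] algebraMap K F r = algebraMap K F r ⊗ₜ 1 := by
        simp [Algebra.algebraMap_eq_smul_one, smul_tmul']
      rw [EE, D_alg_l hL, D_alg_r hL]
      nth_rewrite 2 [h]
      simp [Algebra.commutes]
    · simp [DJac_alg_b D hL]
    · simp [DJac_alg_a D hL, D_alg_l hL]
  | grade1 i =>
    refine ⟨1 ⊗ₜ x i + x i ⊗ₜ 1, fun j => ?_, fun j k => ?_, fun k => ⟨0, fun j => ?_⟩⟩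
    · rw [hE]
      simp only [add_mul, mul_add, Algebra.TensorProduct.tmul_mul_tmul, one_mul, mul_one]
      abel
    · rw [hJ]
      simp
    · rw [hJ]
      simp
  | add a b ha hb =>
    obtain ⟨X, hX, hX', hZ⟩ := ha
    obtain ⟨Y, hY, hY', hW⟩ := hb
    refine ⟨X + Y, fun j => ?_, fun j k => ?_, fun k => ?_⟩
    · have : EE D (a + b) (x j) = EE D a (x j) + EE D b (x j) := by
        simp only [EE, add_tmul, tmul_add, map_add]; abel
      rw [this, hX, hY]
      simp only [add_mul, mul_add, add_tmul, tmul_add]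
      abel
    · rw [DJac_add_b, hX', hY', ← add_mul, ← map_add, tmul_add]
      congr 2
      abel
    · obtain ⟨Z, hZ⟩ := hZ k
      obtain ⟨W, hW⟩ := hW k
      refine ⟨Z + W, fun j => ?_⟩
      rw [DJac_add_a, hZ, hW]
      simp only [add_mul, mul_add, add_tmul, map_add]
      abel
  | mul a b ha hb =>
    obtain ⟨X, hX, hX', hZ⟩ := ha
    obtain ⟨Y, hY, hY', hW⟩ := hb
    refine ⟨(1 ⊗ₜ a) * Y + X * (b ⊗ₜ 1) - b ⊗ₜ a, fun j => ?_, fun j k => ?_, fun k => ?_⟩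
    · rw [E_mul_l hL, hX, hY]
      have c1 : (1 ⊗ₜ a) * ((x j ⊗ₜ 1) * Y) = (x j ⊗ₜ 1) * ((1 ⊗ₜ[K] a) * Y) := by
        simp only [← mul_assoc, Algebra.TensorProduct.tmul_mul_tmul, one_mul, mul_one]
      have c2 : (X * (1 ⊗ₜ x j)) * (b ⊗ₜ 1) = (X * (b ⊗ₜ[K] 1)) * (1 ⊗ₜ x j) := by
        simp only [mul_assoc, Algebra.TensorProduct.tmul_mul_tmul, one_mul, mul_one]
      simp only [add_mul, mul_add, sub_mul, mul_sub, neg_mul, mul_neg, c1, c2, Algebra.TensorProduct.tmul_mul_tmul, one_mul, mul_one, ← mul_assoc]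
      abel
    · rw [DJac_mul_b hL, hX', hY', mul_assoc, ← o_comm, ← mul_assoc, ← mul_assoc, ← add_mul]
      congr 1
      rw [show ((1 : F ⊗[K] F) ⊗ₜ[K] a) = e (1 ⊗ₜ a) by simp [Algebra.TensorProduct.one_def],
        ← e_tmul, ← map_mul, ← map_mul, ← map_add]
      congr 1
      simp only [add_mul, mul_add, sub_mul, mul_sub, Algebra.TensorProduct.tmul_mul_tmul, one_mul, mul_one]
      abel
    · obtain ⟨Z, hZ⟩ := hZ k
      obtain ⟨W, hW⟩ := hW k
      refine ⟨((1 ⊗ₜ a) ⊗ₜ 1) * W + Z * ((b ⊗ₜ 1) ⊗ₜ 1) + (e (fl X) - 1 ⊗ₜ a) * o (D (b ⊗ₜ x k)), fun j => ?_⟩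
      have hf : EE D (x j) a = fl (EE D a (x j)) := by
        simp only [EE, map_add, fl_fl]; rw [add_comm]
      rw [DJac_mul_a hL, hZ, hW, hf, hX, hL.2]
      simp only [map_add, map_sub, map_neg, map_mul, fl_tmul, e_tmul, o_l, o_r, ← Algebra.TensorProduct.one_def]
      have c0 := o_comm (x j) (D (b ⊗ₜ[K] x k))
      have c3 : (((1:F) ⊗ₜ[K] x j) ⊗ₜ[K] (1:F)) * ((1 : F ⊗[K] F) ⊗ₜ[K] a) = ((1 : F ⊗[K] F) ⊗ₜ[K] a) * (((1:F) ⊗ₜ[K] x j) ⊗ₜ[K] (1:F)) := by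
        simp
      have c4 : (((1:F) ⊗ₜ[K] a) ⊗ₜ[K] (1:F)) * ((1 : F ⊗[K] F) ⊗ₜ[K] x j) = ((1 : F ⊗[K] F) ⊗ₜ[K] x j) * (((1:F) ⊗ₜ[K] a) ⊗ₜ[K] (1:F)) := by
        simp
      have c5 : (((1:F) ⊗ₜ[K] x j) ⊗ₜ[K] (1:F)) * ((b ⊗ₜ[K] (1:F)) ⊗ₜ[K] (1:F)) = ((b ⊗ₜ[K] (1:F)) ⊗ₜ[K] (1:F)) * (((1:F) ⊗ₜ[K] x j) ⊗ₜ[K] (1:F)) := by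
        simp
      have c6 : (((1:F) ⊗ₜ[K] (a * x j)) ⊗ₜ[K] (1:F)) = (((1:F) ⊗ₜ[K] a) ⊗ₜ[K] (1:F)) * (((1:F) ⊗ₜ[K] x j) ⊗ₜ[K] (1:F)) := by
        simp
      have c7 : ((1 : F ⊗[K] F) ⊗ₜ[K] (x j * a)) = ((1 : F ⊗[K] F) ⊗ₜ[K] x j) * ((1 : F ⊗[K] F) ⊗ₜ[K] a) := by
        simp
      rw [c6, c7]
      clear c6 c7
      generalize (((1:F) ⊗ₜ[K] x j) ⊗ₜ[K] (1:F)) = P2 at *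
      generalize ((1 : F ⊗[K] F) ⊗ₜ[K] x j) = P3 at *
      generalize (((1:F) ⊗ₜ[K] a) ⊗ₜ[K] (1:F)) = A2 at *
      generalize ((1 : F ⊗[K] F) ⊗ₜ[K] a) = A3 at *
      generalize ((b ⊗ₜ[K] (1:F)) ⊗ₜ[K] (1:F)) = B1 at *
      generalize o (D (b ⊗ₜ[K] x k)) = O2 at *
      have d4 : ∀ T, A2 * (P3 * T) = P3 * (A2 * T) := fun T => by rw [← mul_assoc, c4, mul_assoc]
      have d3 : ∀ T, P2 * (A3 * T) = A3 * (P2 * T) := fun T => by rw [← mul_assoc, c3, mul_assoc]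
      simp only [add_mul, mul_add, sub_mul, mul_sub, neg_mul, nn2, mul_assoc, d3, d4, c5, c0]
      abel

theorem main (D : F ⊗[K] F →ₗ[K] F ⊗[K] F) (hL : LeibnizRules K F D) (hI : Ind K x)
    (hE : ∀ i j, EE D (x i) (x j) = x j ⊗ₜ x i - x i ⊗ₜ x j)
    (hJ : ∀ i j k, DJac K F D (x i) (x j) (x k) = ((1 ⊗ₜ x j) ⊗ₜ 1) * o (D (x i ⊗ₜ x k))) :
    IsModifiedDoublePoisson K F D := by
  have key := key_all x D hL hI hE hJ
  refine ⟨hL, fun a b => ?_, fun a b c => ?_⟩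
  · obtain ⟨X, hX, -, -⟩ := key a
    have h1 : LinearMap.mul' K F (EE D a b) = (a - LinearMap.mul' K F X) * b - b * (a - LinearMap.mul' K F X) := by
      induction b using hI.induction with
      | grade0 r =>
        simp [EE, D_alg_l hL, D_alg_r hL, Algebra.commutes]
      | grade1 i =>
        rw [hX]
        simp only [map_sub, map_add, map_neg, m_l, m_r, LinearMap.mul'_apply]
        noncomm_ring
      | mul b c hb hc =>
        rw [E_mul_r hL, map_add, m_l, m_r, hb, hc]
        noncomm_ring
      | add b c hb hc =>
        have : EE D a (b + c) = EE D a b + EE D a c := by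
          simp only [EE, add_tmul, tmul_add, map_add]; abel
        rw [this, map_add, hb, hc]
        noncomm_ring
    have h2 : ∀ t : F ⊗[K] F, LinearMap.mul' K F t - LinearMap.mul' K F (fl t) ∈ commutatorSpan K F := by
      intro t
      induction t using TensorProduct.induction_on with
      | zero => simp
      | tmul u v =>
        simp only [fl_tmul, LinearMap.mul'_apply]
        exact Submodule.subset_span ⟨u, v, rfl⟩
      | add y z hy hz =>
        have := add_mem hy hz
        simp only [map_add]
        convert this using 1
        abel
    have h3 : LinearMap.mul' K F (EE D a b) ∈ commutatorSpan K F := by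
      rw [h1]; exact Submodule.subset_span ⟨_, _, rfl⟩
    have h4 := add_mem h3 (h2 (D (b ⊗ₜ a)))
    convert h4 using 1
    simp only [br, EE, map_add]
    abel
  · have hgen : ∀ k, br K F D a (br K F D b (x k)) - br K F D b (br K F D a (x k)) - br K F D (br K F D a b) (x k) = 0 := by
      intro k
      obtain ⟨X, hX, hX', hZ⟩ := key a
      obtain ⟨Z, hZ⟩ := hZ k
      obtain ⟨V, hV⟩ : ∃ V : F ⊗[K] F, ∀ j, PP D a (x j) (x k) = V * (x j ⊗ₜ 1) - (1 ⊗ₜ x j) * V := by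
        refine ⟨m23 (dLfst K F D (x k) (fl X)) + m12 Z, fun j => ?_⟩
        have hf : EE D (x j) a = fl (EE D a (x j)) := by
          simp only [EE, map_add, fl_fl]; rw [add_comm]
        have h0 : m23 (dLfst K F D (x k) (1 ⊗ₜ (x j * a))) = 0 := by
          simp [D_one_l hL]
        have h0' : m23 (dLfst K F D (x k) ((a * x j) ⊗ₜ 1)) = D ((a * x j) ⊗ₜ x k) := by
          rw [dLfst_tmul, q1c, ← Algebra.TensorProduct.one_def, one_mul]
        rw [PP_eq hL, hf, hX, hX', hZ, m23_eo]
        simp only [map_add, map_sub, map_neg, map_mul, fl_tmul, G_l hL, G_r hL, fl_fl, m12_l, m12_r, m12_o, h0, h0', hL.2, LinearMap.mul'_apply, one_mul, tmul_sub, sub_mul, add_mul, mul_add]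
        abel
      have hall : ∀ b, PP D a b (x k) = V * (b ⊗ₜ 1) - (1 ⊗ₜ b) * V := by
        intro b
        induction b using hI.induction with
        | grade0 r =>
          have h : del D a (algebraMap K F r) = 0 := by simp [del, D_alg_r hL]
          have h' : D (algebraMap K F r ⊗ₜ del D a (x k)) = 0 := D_alg_l hL _ _
          simp only [PP, h, h', D_alg_l hL, zero_tmul, map_zero, sub_zero]
          simp [Algebra.algebraMap_eq_smul_one, ← smul_tmul', ← Algebra.TensorProduct.one_def]
        | grade1 i => exact hV i
        | mul b c hb hc =>
          rw [PP_mul hL, hb, hc]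
          have e1 : (b * c) ⊗ₜ[K] (1:F) = (b ⊗ₜ 1) * (c ⊗ₜ 1) := by simp
          have e2 : (1:F) ⊗ₜ[K] (b * c) = (1 ⊗ₜ b) * (1 ⊗ₜ c) := by simp
          rw [e1, e2]
          noncomm_ring
        | add b c hb hc =>
          have : PP D a (b + c) (x k) = PP D a b (x k) + PP D a c (x k) := by
            simp only [PP, add_tmul, map_add]; abel
          rw [this, hb, hc]
          simp only [add_tmul, tmul_add, mul_add, add_mul]
          abel
      have hact : ∀ t : F ⊗[K] F, LinearMap.mul' K F (act D a t) = del D a (LinearMap.mul' K F t) := by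
        intro t
        induction t using TensorProduct.induction_on with
        | zero => simp
        | tmul u v => simp [del_mul hL, add_comm]
        | add y z hy hz => simp only [map_add, hy, hz]
      have hm := congrArg (LinearMap.mul' K F) (hall b)
      rw [map_sub, m_in, sub_self, PP, map_sub, map_sub, hact] at hm
      exact hm
    have hd : ∀ c, del D a (del D b c) - del D b (del D a c) - del D (del D a b) c = 0 := by
      intro c
      induction c using hI.induction with
      | grade0 r =>
        have h : ∀ a, del D a (algebraMap K F r) = 0 := fun a => by simp [del, D_alg_r hL]
        simp [h]
      | grade1 i => exact hgen i
      | mul c d hc hd =>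
        have e3 : del D (del D a b) c = del D a (del D b c) - del D b (del D a c) := (sub_eq_zero.mp hc).symm
        have e4 : del D (del D a b) d = del D a (del D b d) - del D b (del D a d) := (sub_eq_zero.mp hd).symm
        simp only [del_mul hL, map_add, e3, e4]
        noncomm_ring
      | add c d hc hd =>
        have := congrArg₂ (· + ·) hc hd
        simp only [add_zero] at this
        rw [← this]
        simp only [map_add]
        abel
    exact hd c


lemma nn (P Q : (F ⊗[K] F) ⊗[K] F) : P * @Neg.neg _ TensorProduct.neg Q = @Neg.neg _ TensorProduct.neg (P * Q) := by
  have h : P * @Neg.neg _ TensorProduct.neg Q + P * Q = 0 := by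
    rw [← mul_add]
    have : @Neg.neg _ TensorProduct.neg Q + Q = 0 := neg_add_cancel Q
    rw [this, mul_zero]
  exact eq_neg_of_add_eq_zero_left h

theorem three {x : Fin 3 → F} (D : F ⊗[K] F →ₗ[K] F ⊗[K] F) (hL : LeibnizRules K F D) (hI : Ind K x)
    (h11 : D (x 0 ⊗ₜ x 0) = 0) (h22 : D (x 1 ⊗ₜ x 1) = 0) (h33 : D (x 2 ⊗ₜ x 2) = 0)
    (h12 : D (x 0 ⊗ₜ x 1) = -(x 0 ⊗ₜ x 1)) (h21 : D (x 1 ⊗ₜ x 0) = x 0 ⊗ₜ x 1)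
    (h23 : D (x 1 ⊗ₜ x 2) = x 2 ⊗ₜ x 1) (h32 : D (x 2 ⊗ₜ x 1) = -(x 2 ⊗ₜ x 1))
    (h31 : D (x 2 ⊗ₜ x 0) = x 0 ⊗ₜ x 2 - x 2 ⊗ₜ x 0) (h13 : D (x 0 ⊗ₜ x 2) = 0) :
    IsModifiedDoublePoisson K F D := by
  refine main x D hL hI ?_ ?_
  · intro i j
    fin_cases i <;> fin_cases j <;>
      simp [EE, h11, h22, h33, h12, h21, h23, h32, h31, h13] <;> try abel
  · intro i j k
    fin_cases i <;> fin_cases j <;> fin_cases k <;>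
      simp [DJac, h11, h22, h33, h12, h21, h23, h32, h31, h13, add_tmul, sub_tmul, neg_tmul, tmul_sub, tmul_neg, mul_sub, nn] <;> try abel

end FF
end MDP

theorem stmt2 {K : Type*} [Field K] [IsAlgClosed K] [CharZero K]
    (D : FreeAlgebra K (Fin 3) ⊗[K] FreeAlgebra K (Fin 3) →ₗ[K] FreeAlgebra K (Fin 3) ⊗[K] FreeAlgebra K (Fin 3))
    (hL : LeibnizRules K (FreeAlgebra K (Fin 3)) D)
    (h11 : D (FreeAlgebra.ι K (0 : Fin 3) ⊗ₜ[K] FreeAlgebra.ι K (0 : Fin 3)) = 0)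
    (h22 : D (FreeAlgebra.ι K (1 : Fin 3) ⊗ₜ[K] FreeAlgebra.ι K (1 : Fin 3)) = 0)
    (h33 : D (FreeAlgebra.ι K (2 : Fin 3) ⊗ₜ[K] FreeAlgebra.ι K (2 : Fin 3)) = 0)
    (h12 : D (FreeAlgebra.ι K (0 : Fin 3) ⊗ₜ[K] FreeAlgebra.ι K (1 : Fin 3)) = -(FreeAlgebra.ι K (0 : Fin 3) ⊗ₜ[K] FreeAlgebra.ι K (1 : Fin 3)))
    (h21 : D (FreeAlgebra.ι K (1 : Fin 3) ⊗ₜ[K] FreeAlgebra.ι K (0 : Fin 3)) = FreeAlgebra.ι K (0 : Fin 3) ⊗ₜ[K] FreeAlgebra.ι K (1 : Fin 3))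
    (h23 : D (FreeAlgebra.ι K (1 : Fin 3) ⊗ₜ[K] FreeAlgebra.ι K (2 : Fin 3)) = FreeAlgebra.ι K (2 : Fin 3) ⊗ₜ[K] FreeAlgebra.ι K (1 : Fin 3))
    (h32 : D (FreeAlgebra.ι K (2 : Fin 3) ⊗ₜ[K] FreeAlgebra.ι K (1 : Fin 3)) = -(FreeAlgebra.ι K (2 : Fin 3) ⊗ₜ[K] FreeAlgebra.ι K (1 : Fin 3)))
    (h31 : D (FreeAlgebra.ι K (2 : Fin 3) ⊗ₜ[K] FreeAlgebra.ι K (0 : Fin 3)) = FreeAlgebra.ι K (0 : Fin 3) ⊗ₜ[K] FreeAlgebra.ι K (2 : Fin 3) - FreeAlgebra.ι K (2 : Fin 3) ⊗ₜ[K] FreeAlgebra.ι K (0 : Fin 3))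
    (h13 : D (FreeAlgebra.ι K (0 : Fin 3) ⊗ₜ[K] FreeAlgebra.ι K (2 : Fin 3)) = 0) :
    IsModifiedDoublePoisson K (FreeAlgebra K (Fin 3)) D := by
  exact MDP.three D hL (fun g0 g1 hm ha a => FreeAlgebra.induction K (Fin 3) g0 g1 hm ha a)
    h11 h22 h33 h12 h21 h23 h32 h31 h13
end

section
/- Let K be an algebraically closed field of characteristic zero, d ≥ 1, and A = K⟨v1,…,vd⟩ the free associative K-algebra. If ⟪-,-⟫ : A⊗A → A⊗A is a mixed double Poisson algebra structure on A of weight λ = (λ1,…,λd) ∈ K^d, then the operation {a,b} = m(⟪a,b⟫) satisfies the Jacobi identity {a,{b,c}} − {b,{a,c}} − {{a,b},c} = 0 for all a,b,c ∈ A. -/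
open TensorProduct

namespace MixedDouble

section General

variable {K : Type*} [Field K] {A : Type*} [Ring A] [Algebra K A]

/-- embedding into factors 1,2 -/
noncomputable def e12 : A ⊗[K] A →ₐ[K] (A ⊗[K] A) ⊗[K] A := Algebra.TensorProduct.includeLeft

/-- embedding into factors 2,3 -/
noncomputable def e23 : A ⊗[K] A →ₐ[K] (A ⊗[K] A) ⊗[K] A :=
  Algebra.TensorProduct.map Algebra.TensorProduct.includeRight (AlgHom.id K A)

/-- embedding into factors 1,3 -/
noncomputable def e13 : A ⊗[K] A →ₐ[K] (A ⊗[K] A) ⊗[K] A :=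
  Algebra.TensorProduct.map Algebra.TensorProduct.includeLeft (AlgHom.id K A)

/-- embedding into factor 1 -/
noncomputable def e1 (K : Type*) [Field K] {A : Type*} [Ring A] [Algebra K A] (a : A) :
    (A ⊗[K] A) ⊗[K] A := (a ⊗ₜ 1) ⊗ₜ 1

/-- embedding into factor 2 -/
noncomputable def e2 (K : Type*) [Field K] {A : Type*} [Ring A] [Algebra K A] (a : A) :
    (A ⊗[K] A) ⊗[K] A := (1 ⊗ₜ a) ⊗ₜ 1

/-- embedding into factor 3 -/
noncomputable def e3 (K : Type*) [Field K] {A : Type*} [Ring A] [Algebra K A] (a : A) :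
    (A ⊗[K] A) ⊗[K] A := (1 ⊗ₜ 1) ⊗ₜ a

/-- total multiplication -/
noncomputable def m3 (K : Type*) [Field K] (A : Type*) [Ring A] [Algebra K A] :
    (A ⊗[K] A) ⊗[K] A →ₗ[K] A :=
  LinearMap.mul' K A ∘ₗ LinearMap.rTensor A (LinearMap.mul' K A)

lemma m3_tmul (x y z : A) : m3 K A ((x ⊗ₜ y) ⊗ₜ z) = x * y * z := by
  simp [m3]

lemma e12_tmul (x y : A) : e12 (x ⊗ₜ[K] y) = (x ⊗ₜ[K] y) ⊗ₜ[K] (1 : A) := by simp [e12]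
lemma e13_tmul (x y : A) : e13 (x ⊗ₜ[K] y) = (x ⊗ₜ[K] (1 : A)) ⊗ₜ[K] y := by simp [e13]
lemma e23_tmul (x y : A) : e23 (x ⊗ₜ[K] y) = ((1 : A) ⊗ₜ[K] x) ⊗ₜ[K] y := by simp [e23]

lemma e12_l (a : A) : e12 (a ⊗ₜ[K] (1 : A)) = e1 K a := e12_tmul _ _
lemma e12_r (a : A) : e12 ((1 : A) ⊗ₜ[K] a) = e2 K a := e12_tmul _ _
lemma e13_l (a : A) : e13 (a ⊗ₜ[K] (1 : A)) = e1 K a := e13_tmul _ _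
lemma e13_r (a : A) : e13 ((1 : A) ⊗ₜ[K] a) = e3 K a := e13_tmul _ _
lemma e23_l (a : A) : e23 (a ⊗ₜ[K] (1 : A)) = e2 K a := e23_tmul _ _
lemma e23_r (a : A) : e23 ((1 : A) ⊗ₜ[K] a) = e3 K a := e23_tmul _ _

lemma e1_mul (a b : A) : e1 K (a * b) = e1 K a * e1 K b := by simp [e1]
lemma e2_mul (a b : A) : e2 K (a * b) = e2 K a * e2 K b := by simp [e2]
lemma e3_mul (a b : A) : e3 K (a * b) = e3 K a * e3 K b := by simp [e3]

lemma e12_pure (x y : A) : e12 (x ⊗ₜ[K] y) = e1 K x * e2 K y := by simp [e12_tmul, e1, e2]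
lemma e13_pure (x y : A) : e13 (x ⊗ₜ[K] y) = e1 K x * e3 K y := by simp [e13_tmul, e1, e3]
lemma e23_pure (x y : A) : e23 (x ⊗ₜ[K] y) = e2 K x * e3 K y := by simp [e23_tmul, e2, e3]

lemma e1_e2 (a b : A) : e1 K a * e2 K b = e2 K b * e1 K a := by simp [e1, e2]
lemma e1_e3 (a b : A) : e1 K a * e3 K b = e3 K b * e1 K a := by simp [e1, e3]
lemma e2_e3 (a b : A) : e2 K a * e3 K b = e3 K b * e2 K a := by simp [e2, e3]

lemma e3_e12 (a : A) (w : A ⊗[K] A) : e3 K a * e12 w = e12 w * e3 K a := by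
  induction w with
  | zero => simp
  | tmul x y => simp [e12_tmul, e3]
  | add x y hx hy => rw [map_add, mul_add, add_mul, hx, hy]

lemma e2_e13 (a : A) (w : A ⊗[K] A) : e2 K a * e13 w = e13 w * e2 K a := by
  induction w with
  | zero => simp
  | tmul x y => simp [e13_tmul, e2]
  | add x y hx hy => rw [map_add, mul_add, add_mul, hx, hy]

lemma e1_e23 (a : A) (w : A ⊗[K] A) : e1 K a * e23 w = e23 w * e1 K a := by
  induction w with
  | zero => simp
  | tmul x y => simp [e23_tmul, e1]
  | add x y hx hy => rw [map_add, mul_add, add_mul, hx, hy]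

lemma m3_e2_r (t : (A ⊗[K] A) ⊗[K] A) (p : A) : m3 K A (t * e2 K p) = m3 K A (e3 K p * t) := by
  induction t with
  | zero => simp
  | tmul w z =>
    induction w with
    | zero => simp
    | tmul x y => simp [e2, e3, m3_tmul, mul_assoc]
    | add x y hx hy => simp only [add_tmul, add_mul, mul_add, map_add, hx, hy]
  | add x y hx hy => simp only [add_mul, mul_add, map_add, hx, hy]

lemma m3_e1_r (t : (A ⊗[K] A) ⊗[K] A) (p : A) : m3 K A (t * e1 K p) = m3 K A (e2 K p * t) := by
  induction t with
  | zero => simp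
  | tmul w z =>
    induction w with
    | zero => simp
    | tmul x y => simp [e2, e1, m3_tmul, mul_assoc]
    | add x y hx hy => simp only [add_tmul, add_mul, mul_add, map_add, hx, hy]
  | add x y hx hy => simp only [add_mul, mul_add, map_add, hx, hy]

lemma m3_ins (w x : A ⊗[K] A) : m3 K A (e13 w * e12 x) = m3 K A (e23 x * e13 w) := by
  induction w with
  | zero => simp
  | tmul p q =>
    induction x with
    | zero => simp
    | tmul x y => simp [e13_tmul, e12_tmul, e23_tmul, m3_tmul, mul_assoc]
    | add x y hx hy => simp only [add_mul, mul_add, map_add, hx, hy]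
  | add x y hx hy => simp only [add_mul, mul_add, map_add, hx, hy]

lemma flipT_tmul (x y : A) : flipT K A (x ⊗ₜ y) = y ⊗ₜ x := by simp [flipT]

lemma flipT_mul (x y : A ⊗[K] A) : flipT K A (x * y) = flipT K A x * flipT K A y := by
  induction x with
  | zero => simp
  | tmul p q =>
    induction y with
    | zero => simp
    | tmul x y => simp [flipT_tmul]
    | add x y hx hy => simp only [mul_add, map_add, hx, hy]
  | add x y hx hy => simp only [add_mul, map_add, hx, hy]

lemma flipT_flipT (x : A ⊗[K] A) : flipT K A (flipT K A x) = x := by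
  induction x with
  | zero => simp
  | tmul p q => simp [flipT_tmul]
  | add x y hx hy => simp only [map_add, hx, hy]

lemma dL_tmul (D : A ⊗[K] A →ₗ[K] A ⊗[K] A) (a x y : A) :
    dL K A D a (x ⊗ₜ y) = e12 (D (a ⊗ₜ x)) * e3 K y := by
  simp only [dL, LinearMap.rTensor_tmul, LinearMap.comp_apply, TensorProduct.mk_apply]
  generalize D (a ⊗ₜ x) = w
  induction w with
  | zero => simp
  | tmul p q => simp [e12_tmul, e3]
  | add x y hx hy => simp only [add_mul, map_add, add_tmul, hx, hy]

lemma dR_tmul (D : A ⊗[K] A →ₗ[K] A ⊗[K] A) (a x y : A) :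
    dR K A D a (x ⊗ₜ y) = e1 K x * e23 (D (a ⊗ₜ y)) := by
  simp only [dR, LinearMap.lTensor_tmul, LinearMap.comp_apply, TensorProduct.mk_apply]
  generalize D (a ⊗ₜ y) = w
  induction w with
  | zero => simp
  | tmul p q => simp [e23_tmul, e1]
  | add x y hx hy => simp only [mul_add, map_add, tmul_add, hx, hy]

lemma dLfst_tmul (D : A ⊗[K] A →ₗ[K] A ⊗[K] A) (c x y : A) :
    dLfst K A D c (x ⊗ₜ y) = e2 K y * e13 (D (x ⊗ₜ c)) := by
  simp only [dLfst, swap23, LinearMap.rTensor_tmul, LinearMap.comp_apply, TensorProduct.mk_apply,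
    LinearMap.flip_apply]
  generalize D (x ⊗ₜ c) = w
  induction w with
  | zero => simp
  | tmul p q => simp [e13_tmul, e2]
  | add x y hx hy => simp only [mul_add, map_add, add_tmul, hx, hy]

lemma otimes1_eq (c : A) (w : A ⊗[K] A) : otimes1 K A c w = e2 K c * e13 w := by
  induction w with
  | zero => simp
  | tmul p q => simp [e13_tmul, e2, otimes1]
  | add x y hx hy => simp only [mul_add, map_add, hx, hy]

/-! ### Leibniz-type formulas -/

variable {D : A ⊗[K] A →ₗ[K] A ⊗[K] A}

lemma dL_lr (x : A ⊗[K] A) (a p : A) :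
    dL K A D a ((1 ⊗ₜ p) * x) = e3 K p * dL K A D a x := by
  induction x with
  | zero => simp
  | tmul y z =>
    rw [Algebra.TensorProduct.tmul_mul_tmul, one_mul, dL_tmul, dL_tmul, e3_mul, ← mul_assoc,
      ← mul_assoc, e3_e12]
  | add x y hx hy => simp only [mul_add, map_add, hx, hy]

lemma dL_rl (hD : LeibnizRules K A D) (x : A ⊗[K] A) (a p : A) :
    dL K A D a (x * (p ⊗ₜ 1)) = dL K A D a x * e2 K p + e13 x * e12 (D (a ⊗ₜ p)) := by
  induction x with
  | zero => simp
  | tmul y z =>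
    rw [Algebra.TensorProduct.tmul_mul_tmul, mul_one, dL_tmul, dL_tmul, hD.1, map_add, map_mul,
      map_mul, e12_l, e12_r, add_mul, add_comm, e13_pure]
    simp only [mul_assoc, e2_e3, e3_e12]
  | add x y hx hy => simp only [add_mul, map_add, hx, hy]; abel

lemma dL_mul (hD : LeibnizRules K A D) (x : A ⊗[K] A) (a b : A) :
    dL K A D (a * b) x = e2 K a * dL K A D b x + dL K A D a x * e1 K b := by
  induction x with
  | zero => simp
  | tmul y z =>
    rw [dL_tmul, dL_tmul, dL_tmul, hD.2, map_add, map_mul,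
      map_mul, e12_l, e12_r, add_mul]
    simp only [mul_assoc, e1_e3]
  | add x y hx hy => simp only [add_mul, mul_add, map_add, hx, hy]; abel

lemma dR_lr (hD : LeibnizRules K A D) (x : A ⊗[K] A) (a p : A) :
    dR K A D a ((1 ⊗ₜ p) * x) = e2 K p * dR K A D a x + e23 (D (a ⊗ₜ p)) * e13 x := by
  induction x with
  | zero => simp
  | tmul y z =>
    rw [Algebra.TensorProduct.tmul_mul_tmul, one_mul, dR_tmul, dR_tmul, hD.1, map_add, map_mul,
      map_mul, e23_l, e23_r, mul_add, e13_pure]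
    simp only [← mul_assoc, e1_e2, e1_e23]
    rw [mul_assoc (e2 K p), e1_e23, ← mul_assoc]
  | add x y hx hy => simp only [mul_add, map_add, hx, hy]; abel

lemma dR_rl (x : A ⊗[K] A) (a p : A) :
    dR K A D a (x * (p ⊗ₜ 1)) = dR K A D a x * e1 K p := by
  induction x with
  | zero => simp
  | tmul y z =>
    rw [Algebra.TensorProduct.tmul_mul_tmul, mul_one, dR_tmul, dR_tmul, e1_mul, mul_assoc,
      mul_assoc, e1_e23]
  | add x y hx hy => simp only [add_mul, map_add, hx, hy]

lemma dR_mul (hD : LeibnizRules K A D) (x : A ⊗[K] A) (a b : A) :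
    dR K A D (a * b) x = e3 K a * dR K A D b x + dR K A D a x * e2 K b := by
  induction x with
  | zero => simp
  | tmul y z =>
    rw [dR_tmul, dR_tmul, dR_tmul, hD.2, map_add, map_mul,
      map_mul, e23_l, e23_r, mul_add]
    simp only [← mul_assoc, e1_e3]
  | add x y hx hy => simp only [add_mul, mul_add, map_add, hx, hy]; abel

lemma dF_rr (x : A ⊗[K] A) (c p : A) :
    dLfst K A D c (x * (1 ⊗ₜ p)) = dLfst K A D c x * e2 K p := by
  induction x with
  | zero => simp
  | tmul y z =>
    rw [Algebra.TensorProduct.tmul_mul_tmul, mul_one, dLfst_tmul, dLfst_tmul, e2_mul, mul_assoc,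
      mul_assoc, e2_e13]
  | add x y hx hy => simp only [add_mul, map_add, hx, hy]

lemma dF_lr (x : A ⊗[K] A) (c p : A) :
    dLfst K A D c ((1 ⊗ₜ p) * x) = e2 K p * dLfst K A D c x := by
  induction x with
  | zero => simp
  | tmul y z =>
    rw [Algebra.TensorProduct.tmul_mul_tmul, one_mul, dLfst_tmul, dLfst_tmul, e2_mul, mul_assoc]
  | add x y hx hy => simp only [mul_add, map_add, hx, hy]

lemma dF_ll (hD : LeibnizRules K A D) (x : A ⊗[K] A) (c p : A) :
    dLfst K A D c ((p ⊗ₜ 1) * x) = e3 K p * dLfst K A D c x + e13 (D (p ⊗ₜ c)) * e12 x := by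
  induction x with
  | zero => simp
  | tmul y z =>
    rw [Algebra.TensorProduct.tmul_mul_tmul, one_mul, dLfst_tmul, dLfst_tmul, hD.2, map_add,
      map_mul, map_mul, e13_l, e13_r, mul_add, e12_pure, e1_e2]
    simp only [← mul_assoc, e2_e3, e2_e13]
    rw [mul_assoc (e3 K p), e2_e13, ← mul_assoc]
  | add x y hx hy => simp only [mul_add, map_add, hx, hy]; abel

lemma dF_rl (hD : LeibnizRules K A D) (x : A ⊗[K] A) (c p : A) :
    dLfst K A D c (x * (p ⊗ₜ 1)) =
      dLfst K A D c x * e1 K p + e23 (flipT K A x) * e13 (D (p ⊗ₜ c)) := by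
  induction x with
  | zero => simp
  | tmul y z =>
    rw [Algebra.TensorProduct.tmul_mul_tmul, mul_one, dLfst_tmul, dLfst_tmul, hD.2, map_add,
      map_mul, map_mul, e13_l, e13_r, mul_add, flipT_tmul, e23_pure, add_comm]
    simp only [← mul_assoc]
  | add x y hx hy => simp only [add_mul, map_add, hx, hy]; abel

lemma DJac_mul_mid (hD : LeibnizRules K A D) (a b b' c : A) :
    DJac K A D a (b * b') c = e3 K b * DJac K A D a b' c + DJac K A D a b c * e2 K b' := by
  simp only [DJac, hD.1 a, hD.2 b, map_add, dL_lr, dL_rl hD, dR_mul hD, dF_ll hD, dF_rr]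
  simp only [mul_add, add_mul, mul_sub, sub_mul, mul_assoc]
  abel

/-- symmetrized bracket -/
noncomputable def SS (D : A ⊗[K] A →ₗ[K] A ⊗[K] A) (a b : A) : A ⊗[K] A :=
  D (a ⊗ₜ b) + flipT K A (D (b ⊗ₜ a))

lemma DJac_mul_left (hD : LeibnizRules K A D) (a a' b c : A) :
    DJac K A D (a * a') b c = e2 K a * DJac K A D a' b c + DJac K A D a b c * e1 K a'
      - e23 (SS D b a) * e13 (D (a' ⊗ₜ c)) := by
  simp only [DJac, SS, hD.2 a, map_add, dR_lr hD, dR_rl, dL_mul hD, dF_lr, dF_rl hD]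
  simp only [mul_add, add_mul, mul_sub, sub_mul, mul_assoc]
  abel

lemma SS_mul_left (hD : LeibnizRules K A D) (a b c : A) :
    SS D (a * b) c = (1 ⊗ₜ a) * SS D b c + SS D a c * (b ⊗ₜ 1) := by
  simp only [SS, hD.1 c, hD.2 a, map_add, flipT_mul, flipT_tmul]
  noncomm_ring

lemma SS_flip (a b : A) : flipT K A (SS D a b) = SS D b a := by
  simp only [SS, map_add, flipT_flipT]; abel

lemma SS_mul_right (hD : LeibnizRules K A D) (a b c : A) :
    SS D a (b * c) = (b ⊗ₜ 1) * SS D a c + SS D a b * (1 ⊗ₜ c) := by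
  simp only [SS, hD.1 a, hD.2 b, map_add, flipT_mul, flipT_tmul]
  noncomm_ring

lemma D_one_left (hD : LeibnizRules K A D) (c : A) : D (1 ⊗ₜ c) = 0 := by
  have h := hD.2 1 1 c
  rw [mul_one, ← Algebra.TensorProduct.one_def, one_mul, mul_one] at h
  simpa using h

lemma D_one_right (hD : LeibnizRules K A D) (c : A) : D (c ⊗ₜ 1) = 0 := by
  have h := hD.1 c 1 1
  rw [mul_one, ← Algebra.TensorProduct.one_def, one_mul, mul_one] at h
  simpa using h

/-! ### The bracket -/

lemma br_mul_right (hD : LeibnizRules K A D) (a b c : A) :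
    br K A D a (b * c) = b * br K A D a c + br K A D a b * c := by
  have h1 : ∀ w : A ⊗[K] A, LinearMap.mul' K A ((b ⊗ₜ 1) * w) = b * LinearMap.mul' K A w := by
    intro w
    induction w with
    | zero => simp
    | tmul x y => simp [mul_assoc]
    | add x y hx hy => simp only [mul_add, map_add, hx, hy]
  have h2 : ∀ w : A ⊗[K] A, LinearMap.mul' K A (w * (1 ⊗ₜ c)) = LinearMap.mul' K A w * c := by
    intro w
    induction w with
    | zero => simp
    | tmul x y => simp [mul_assoc]
    | add x y hx hy => simp only [add_mul, map_add, hx, hy]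
  rw [br, hD.1, map_add, h1, h2]; rfl

lemma br_add_right (a b c : A) : br K A D a (b + c) = br K A D a b + br K A D a c := by
  simp only [br, tmul_add, map_add]

lemma br_add_left (a b c : A) : br K A D (a + b) c = br K A D a c + br K A D b c := by
  simp only [br, add_tmul, map_add]

lemma br_smul_right (r : K) (a b : A) : br K A D a (r • b) = r • br K A D a b := by
  simp only [br, tmul_smul, map_smul]

lemma br_one_right (hD : LeibnizRules K A D) (a : A) : br K A D a 1 = 0 := by
  simp only [br, D_one_right hD, map_zero]

lemma br_zero_right (a : A) : br K A D a 0 = 0 := by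
  simp only [br, tmul_zero, map_zero]

lemma br_zero_left (a : A) : br K A D 0 a = 0 := by
  simp only [br, zero_tmul, map_zero]

lemma br_mul'_right (hD : LeibnizRules K A D) (a : A) (x : A ⊗[K] A) :
    br K A D a (LinearMap.mul' K A x) = m3 K A (dL K A D a x + dR K A D a x) := by
  induction x with
  | zero => simp [br_zero_right]
  | tmul y z =>
    rw [LinearMap.mul'_apply, br_mul_right hD, dL_tmul, dR_tmul, br, br, map_add, add_comm]
    congr 1
    · generalize D (a ⊗ₜ y) = w
      induction w with
      | zero => simp
      | tmul p q => simp [e12_tmul, e3, m3_tmul]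
      | add x y hx hy => simp only [add_mul, map_add, hx, hy]
    · generalize D (a ⊗ₜ z) = w
      induction w with
      | zero => simp
      | tmul p q => simp [e23_tmul, e1, m3_tmul, mul_assoc]
      | add x y hx hy => simp only [mul_add, map_add, hx, hy]
  | add x y hx hy => simp only [map_add, br_add_right, hx, hy]; abel

lemma br_mul'_left (hD : LeibnizRules K A D) (c : A) (x : A ⊗[K] A) :
    br K A D (LinearMap.mul' K A x) c =
      m3 K A (dLfst K A D c x + dLfst K A D c (flipT K A x)) := by
  induction x with
  | zero => simp [br_zero_left]
  | tmul y z =>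
    rw [LinearMap.mul'_apply, br, hD.2, flipT_tmul, dLfst_tmul, dLfst_tmul, map_add, map_add,
      add_comm]
    congr 1
    · generalize D (y ⊗ₜ c) = w
      induction w with
      | zero => simp
      | tmul p q => simp [e13_tmul, e2, m3_tmul]
      | add x y hx hy => simp only [add_mul, mul_add, map_add, hx, hy]
    · generalize D (z ⊗ₜ c) = w
      induction w with
      | zero => simp
      | tmul p q => simp [e13_tmul, e2, m3_tmul, mul_assoc]
      | add x y hx hy => simp only [mul_add, map_add, hx, hy]
  | add x y hx hy => simp only [map_add, br_add_left, hx, hy]; abel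

lemma jac_eq (hD : LeibnizRules K A D) (a b c : A) :
    br K A D a (br K A D b c) - br K A D b (br K A D a c) - br K A D (br K A D a b) c =
      m3 K A (DJac K A D a b c) - m3 K A (DJac K A D b a c)
        - m3 K A (dLfst K A D c (SS D b a)) := by
  have h1 := br_mul'_right hD a (D (b ⊗ₜ c))
  have h2 := br_mul'_right hD b (D (a ⊗ₜ c))
  have h3 := br_mul'_left hD c (D (a ⊗ₜ b))
  simp only [br] at h1 h2 h3 ⊢
  rw [h1, h2, h3]
  simp only [DJac, SS, map_add, map_sub]
  abel

/-- The key computation, given `g` and the structural formulas. -/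
lemma jac_zero (hD : LeibnizRules K A D) (g : A → A ⊗[K] A) (a b c : A)
    (hS : SS D b a = flipT K A (g b) * (1 ⊗ₜ a) - (a ⊗ₜ 1) * flipT K A (g b)
      + g a * (b ⊗ₜ 1) - (1 ⊗ₜ b) * g a)
    (h1 : ∃ U, DJac K A D a b c = - (e23 (flipT K A (g b)) * e13 (D (a ⊗ₜ c)))
      + (U * e2 K b - e3 K b * U))
    (h2 : ∃ U, DJac K A D b a c = - (e23 (flipT K A (g a)) * e13 (D (b ⊗ₜ c)))
      + (U * e2 K a - e3 K a * U)) :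
    br K A D a (br K A D b c) - br K A D b (br K A D a c) - br K A D (br K A D a b) c = 0 := by
  obtain ⟨U, hU⟩ := h1
  obtain ⟨V, hV⟩ := h2
  rw [jac_eq hD, hU, hV, hS]
  simp only [map_add, map_sub, map_neg, dF_rr, dF_ll hD, dF_rl hD, dF_lr, m3_e2_r, m3_e1_r, m3_ins]
  abel

end General

section Free

variable {K : Type*} [Field K] {ι : Type*}

lemma free_ind {C : FreeAlgebra K ι → Prop} (h1 : C 1) (hv : ∀ i, C (FreeAlgebra.ι K i))
    (hm : ∀ a b, C a → C b → C (a * b)) (ha : ∀ a b, C a → C b → C (a + b))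
    (hs : ∀ (r : K) a, C a → C (r • a)) (a : FreeAlgebra K ι) : C a := by
  induction a using FreeAlgebra.induction with
  | grade0 r => rw [Algebra.algebraMap_eq_smul_one]; exact hs _ _ h1
  | grade1 x => exact hv x
  | mul a b h h' => exact hm a b h h'
  | add a b h h' => exact ha a b h h'

lemma exists_g (u : ι → FreeAlgebra K ι ⊗[K] FreeAlgebra K ι) :
    ∃ g : FreeAlgebra K ι →ₗ[K] FreeAlgebra K ι ⊗[K] FreeAlgebra K ι,
      (∀ i, g (FreeAlgebra.ι K i) = u i) ∧
      ∀ a b, g (a * b) = (a ⊗ₜ 1) * g b + g a * (1 ⊗ₜ b) := by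
  let φ : FreeAlgebra K ι →ₐ[K]
      Matrix (Fin 2) (Fin 2) (FreeAlgebra K ι ⊗[K] FreeAlgebra K ι) :=
    FreeAlgebra.lift K (fun i =>
      !![(FreeAlgebra.ι K i) ⊗ₜ[K] 1, u i; 0, 1 ⊗ₜ[K] (FreeAlgebra.ι K i)])
  have hφ : ∀ a, φ a 0 0 = a ⊗ₜ 1 ∧ φ a 1 1 = 1 ⊗ₜ a ∧ φ a 1 0 = 0 := by
    intro a
    induction a using free_ind with
    | h1 => simp [Algebra.TensorProduct.one_def]
    | hv i => simp [φ]
    | hm a b h h' =>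
      simp [map_mul, Matrix.mul_apply, Fin.sum_univ_two, h, h']
    | ha a b h h' => simp [h, h', add_tmul, tmul_add]
    | hs r a h => simp [h, smul_tmul']
  refine ⟨{ toFun := fun a => φ a 0 1, map_add' := ?_, map_smul' := ?_ }, ?_, ?_⟩
  · intro a b; simp
  · intro r a; simp
  · intro i; simp [φ]
  · intro a b
    simp [map_mul, Matrix.mul_apply, Fin.sum_univ_two, hφ]

variable {D : FreeAlgebra K ι ⊗[K] FreeAlgebra K ι →ₗ[K] FreeAlgebra K ι ⊗[K] FreeAlgebra K ι}
  {lam : ι → K} {g : FreeAlgebra K ι →ₗ[K] FreeAlgebra K ι ⊗[K] FreeAlgebra K ι}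

lemma g_one (hg : ∀ a b, g (a * b) = (a ⊗ₜ 1) * g b + g a * (1 ⊗ₜ b)) : g 1 = 0 := by
  have h := hg 1 1
  rw [mul_one, ← Algebra.TensorProduct.one_def, one_mul, mul_one] at h
  simpa using h

/-- The right-hand side of the formula for the symmetrized bracket. -/
noncomputable def SR (g : FreeAlgebra K ι →ₗ[K] FreeAlgebra K ι ⊗[K] FreeAlgebra K ι)
    (b a : FreeAlgebra K ι) : FreeAlgebra K ι ⊗[K] FreeAlgebra K ι :=
  flipT K _ (g b) * (1 ⊗ₜ a) - (a ⊗ₜ 1) * flipT K _ (g b) + g a * (b ⊗ₜ 1) - (1 ⊗ₜ b) * g a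

lemma lr_comm {A : Type*} [Ring A] [Algebra K A] (a b : A) :
    (a ⊗ₜ[K] (1 : A)) * ((1 : A) ⊗ₜ[K] b) = ((1 : A) ⊗ₜ[K] b) * (a ⊗ₜ[K] (1 : A)) := by simp

lemma l_mul {A : Type*} [Ring A] [Algebra K A] (a b : A) :
    ((a * b) ⊗ₜ[K] (1 : A)) = (a ⊗ₜ[K] (1 : A)) * (b ⊗ₜ[K] (1 : A)) := by simp

lemma r_mul {A : Type*} [Ring A] [Algebra K A] (a b : A) :
    ((1 : A) ⊗ₜ[K] (a * b)) = ((1 : A) ⊗ₜ[K] a) * ((1 : A) ⊗ₜ[K] b) := by simp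

lemma lr_comm_assoc {A : Type*} [Ring A] [Algebra K A] (a b : A) (x : A ⊗[K] A) :
    (a ⊗ₜ[K] (1 : A)) * (((1 : A) ⊗ₜ[K] b) * x) =
      ((1 : A) ⊗ₜ[K] b) * ((a ⊗ₜ[K] (1 : A)) * x) := by
  rw [← mul_assoc, lr_comm, mul_assoc]

lemma SR_mul_left (hg : ∀ a b, g (a * b) = (a ⊗ₜ 1) * g b + g a * (1 ⊗ₜ b))
    (a b c : FreeAlgebra K ι) :
    SR g (a * b) c = (1 ⊗ₜ a) * SR g b c + SR g a c * (b ⊗ₜ 1) := by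
  simp only [SR, hg a b, map_add, flipT_mul, flipT_tmul, l_mul, r_mul]
  simp only [mul_add, add_mul, mul_sub, sub_mul, mul_assoc, lr_comm, lr_comm_assoc]
  abel

lemma SR_mul_right (hg : ∀ a b, g (a * b) = (a ⊗ₜ 1) * g b + g a * (1 ⊗ₜ b))
    (a b c : FreeAlgebra K ι) :
    SR g a (b * c) = (b ⊗ₜ 1) * SR g a c + SR g a b * (1 ⊗ₜ c) := by
  simp only [SR, hg b c, map_add, l_mul, r_mul]
  simp only [mul_add, add_mul, mul_sub, sub_mul, mul_assoc, lr_comm, lr_comm_assoc]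
  abel

lemma SS_eq_SR [CharZero K] (hD : IsMixedDouble K (FreeAlgebra K ι) (FreeAlgebra.ι K) lam D)
    (hv : ∀ i, g (FreeAlgebra.ι K i) =
      (lam i / 2) • (FreeAlgebra.ι K i ⊗ₜ[K] 1 + 1 ⊗ₜ[K] FreeAlgebra.ι K i))
    (hg : ∀ a b, g (a * b) = (a ⊗ₜ 1) * g b + g a * (1 ⊗ₜ b)) (b a : FreeAlgebra K ι) :
    SS D b a = SR g b a := by
  induction b using free_ind with
  | h1 => simp [SS, SR, D_one_left hD.1, D_one_right hD.1, g_one hg,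
      ← Algebra.TensorProduct.one_def]
  | hm b c h h' => rw [SS_mul_left hD.1, SR_mul_left hg, h, h']
  | ha b c h h' =>
    have e1 : SS D (b + c) a = SS D b a + SS D c a := by
      simp only [SS, add_tmul, tmul_add, map_add]; abel
    have e2 : SR g (b + c) a = SR g b a + SR g c a := by
      simp only [SR, add_tmul, tmul_add, map_add, mul_add, add_mul]; abel
    rw [e1, e2, h, h']
  | hs r b h =>
    have e1 : SS D (r • b) a = r • SS D b a := by
      simp only [SS, ← smul_tmul', tmul_smul, map_smul, smul_add]
    have e2 : SR g (r • b) a = r • SR g b a := by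
      simp only [SR, ← smul_tmul', tmul_smul, map_smul, smul_add, smul_sub, smul_mul_assoc,
        mul_smul_comm]
    rw [e1, e2, h]
  | hv i =>
    induction a using free_ind with
    | h1 => simp [SS, SR, D_one_left hD.1, D_one_right hD.1, g_one hg,
        ← Algebra.TensorProduct.one_def]
    | hm b c h h' => rw [SS_mul_right hD.1, SR_mul_right hg, h, h']
    | ha b c h h' =>
      have e1 : ∀ a, SS D a (b + c) = SS D a b + SS D a c := by
        intro a; simp only [SS, add_tmul, tmul_add, map_add]; abel
      have e2 : ∀ a, SR g a (b + c) = SR g a b + SR g a c := by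
        intro a; simp only [SR, add_tmul, tmul_add, map_add, mul_add, add_mul]; abel
      rw [e1, e2, h, h']
    | hs r b h =>
      have e1 : ∀ a, SS D a (r • b) = r • SS D a b := by
        intro a; simp only [SS, ← smul_tmul', tmul_smul, map_smul, smul_add]
      have e2 : ∀ a, SR g a (r • b) = r • SR g a b := by
        intro a
        simp only [SR, ← smul_tmul', tmul_smul, map_smul, smul_add, smul_sub, smul_mul_assoc,
          mul_smul_comm]
      rw [e1, e2, h]
    | hv j =>
      rw [SS, hD.2, SR, hv, hv]
      simp only [map_smul, map_add, flipT_tmul, smul_mul_assoc, mul_smul_comm, add_mul, mul_add,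
        Algebra.TensorProduct.tmul_mul_tmul, one_mul, mul_one]
      module

lemma T_neg_mul {A : Type*} [Ring A] [Algebra K A] (s t : (A ⊗[K] A) ⊗[K] A) :
    (-s) * t = -(s * t) := neg_mul s t

lemma T_mul_neg {A : Type*} [Ring A] [Algebra K A] (s t : (A ⊗[K] A) ⊗[K] A) :
    s * (-t) = -(s * t) := mul_neg s t

lemma DJac_gen (hD : IsMixedDoublePoisson K (FreeAlgebra K ι) (FreeAlgebra.ι K) lam D)
    (hv : ∀ i, g (FreeAlgebra.ι K i) =
      (lam i / 2) • (FreeAlgebra.ι K i ⊗ₜ[K] 1 + 1 ⊗ₜ[K] FreeAlgebra.ι K i))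
    (hg : ∀ a b, g (a * b) = (a ⊗ₜ 1) * g b + g a * (1 ⊗ₜ b)) (i k : ι)
    (b : FreeAlgebra K ι) :
    DJac K _ D (FreeAlgebra.ι K i) b (FreeAlgebra.ι K k) =
      - (e23 (flipT K _ (g b)) * e13 (D (FreeAlgebra.ι K i ⊗ₜ FreeAlgebra.ι K k)))
      - (lam i / 2) • (e13 (D (FreeAlgebra.ι K i ⊗ₜ FreeAlgebra.ι K k)) * e2 K b
        - e3 K b * e13 (D (FreeAlgebra.ι K i ⊗ₜ FreeAlgebra.ι K k))) := by
  have hL := hD.1.1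
  induction b using free_ind with
  | h1 =>
    have : DJac K _ D (FreeAlgebra.ι K i) 1 (FreeAlgebra.ι K k) = 0 := by
      have h := DJac_mul_mid hL (FreeAlgebra.ι K i) 1 1 (FreeAlgebra.ι K k)
      have h2 : e2 K (1 : FreeAlgebra K ι) = 1 := rfl
      have h3 : e3 K (1 : FreeAlgebra K ι) = 1 := rfl
      rw [mul_one, h2, h3, one_mul, mul_one] at h
      simpa using h
    have h2 : e2 K (1 : FreeAlgebra K ι) = 1 := rfl
    have h3 : e3 K (1 : FreeAlgebra K ι) = 1 := rfl
    rw [this, g_one hg, h2, h3]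
    simp
  | hm b c h h' =>
    rw [DJac_mul_mid hL, h, h', hg]
    simp only [map_add, map_mul, flipT_mul, flipT_tmul, e23_l, e23_r, e2_mul, e3_mul]
    generalize D (FreeAlgebra.ι K i ⊗ₜ FreeAlgebra.ι K k) = w
    simp only [mul_add, add_mul, mul_sub, sub_mul, mul_assoc, T_neg_mul, T_mul_neg, e2_e13,
      smul_mul_assoc, mul_smul_comm, smul_sub]
    abel
  | ha b c h h' =>
    have h1 : DJac K _ D (FreeAlgebra.ι K i) (b + c) (FreeAlgebra.ι K k) =
        DJac K _ D (FreeAlgebra.ι K i) b (FreeAlgebra.ι K k) +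
        DJac K _ D (FreeAlgebra.ι K i) c (FreeAlgebra.ι K k) := by
      have : ∀ x, dR K _ D (b + c) x = dR K _ D b x + dR K _ D c x := by
        intro x
        induction x with
        | zero => simp
        | tmul y z => simp only [dR_tmul, add_tmul, map_add, mul_add]
        | add x y hx hy => simp only [map_add, hx, hy]; abel
      simp only [DJac, add_tmul, tmul_add, map_add, this]; abel
    have h2 : e2 K (b + c) = e2 K b + e2 K c := by simp only [e2, add_tmul, tmul_add]
    have h3 : e3 K (b + c) = e3 K b + e3 K c := by simp only [e3, tmul_add]
    rw [h1, h, h', h2, h3]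
    simp only [map_add, mul_add, add_mul, smul_add, smul_sub]
    abel
  | hs r b h =>
    have h1 : DJac K _ D (FreeAlgebra.ι K i) (r • b) (FreeAlgebra.ι K k) =
        r • DJac K _ D (FreeAlgebra.ι K i) b (FreeAlgebra.ι K k) := by
      have : ∀ x, dR K _ D (r • b) x = r • dR K _ D b x := by
        intro x
        induction x with
        | zero => simp
        | tmul y z => simp only [dR_tmul, ← smul_tmul', map_smul, mul_smul_comm]
        | add x y hx hy => simp only [map_add, hx, hy, smul_add]
      simp only [DJac, ← smul_tmul', tmul_smul, map_smul, this, smul_sub]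
    have h2 : e2 K (r • b) = r • e2 K b := by simp only [e2, ← smul_tmul', tmul_smul]
    have h3 : e3 K (r • b) = r • e3 K b := by simp only [e3, tmul_smul]
    rw [h1, h, h2, h3]
    simp only [map_smul, smul_mul_assoc, mul_smul_comm]
    module
  | hv j =>
    rw [hD.2, hv, otimes1_eq, otimes1_eq]
    have h2 : e2 K (1 : FreeAlgebra K ι) = 1 := rfl
    rw [h2, one_mul, map_mul, e13_r, ← e2_e13]
    simp only [map_smul, map_add, flipT_tmul, e23_l, e23_r, smul_mul_assoc, add_mul]
    module

lemma DJac_gen_left [CharZero K]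
    (hD : IsMixedDoublePoisson K (FreeAlgebra K ι) (FreeAlgebra.ι K) lam D)
    (hv : ∀ i, g (FreeAlgebra.ι K i) =
      (lam i / 2) • (FreeAlgebra.ι K i ⊗ₜ[K] 1 + 1 ⊗ₜ[K] FreeAlgebra.ι K i))
    (hg : ∀ a b, g (a * b) = (a ⊗ₜ 1) * g b + g a * (1 ⊗ₜ b)) (k : ι)
    (a b : FreeAlgebra K ι) :
    ∃ U, DJac K _ D a b (FreeAlgebra.ι K k) =
      - (e23 (flipT K _ (g b)) * e13 (D (a ⊗ₜ FreeAlgebra.ι K k)))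
      + (U * e2 K b - e3 K b * U) := by
  have hL := hD.1.1
  have dLadd : ∀ a a' x, dL K _ D (a + a') x = dL K _ D a x + dL K _ D a' x := by
    intro a a' x
    induction x with
    | zero => simp
    | tmul y z => simp only [dL_tmul, add_tmul, map_add, add_mul]
    | add x y hx hy => simp only [map_add, hx, hy]; abel
  have dLsmul : ∀ (r : K) a x, dL K _ D (r • a) x = r • dL K _ D a x := by
    intro r a x
    induction x with
    | zero => simp
    | tmul y z => simp only [dL_tmul, ← smul_tmul', map_smul, smul_mul_assoc]
    | add x y hx hy => simp only [map_add, hx, hy, smul_add]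
  induction a using free_ind with
  | h1 =>
    refine ⟨0, ?_⟩
    have h := dLsmul 0 1 (D (b ⊗ₜ FreeAlgebra.ι K k))
    have : ∀ x, dL K _ D 1 x = 0 := by
      intro x
      induction x with
      | zero => simp
      | tmul y z => simp only [dL_tmul, D_one_left hL, map_zero, zero_mul]
      | add x y hx hy => simp only [map_add, hx, hy, add_zero]
    simp only [DJac, this, D_one_left hL, map_zero, mul_zero, zero_mul, sub_zero, neg_zero,
      add_zero]
  | hv i =>
    refine ⟨-(lam i / 2) • e13 (D (FreeAlgebra.ι K i ⊗ₜ FreeAlgebra.ι K k)), ?_⟩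
    rw [DJac_gen hD hv hg, smul_mul_assoc, mul_smul_comm]
    module
  | ha a a' h h' =>
    obtain ⟨U, h⟩ := h
    obtain ⟨V, h'⟩ := h'
    refine ⟨U + V, ?_⟩
    have h1 : DJac K _ D (a + a') b (FreeAlgebra.ι K k) =
        DJac K _ D a b (FreeAlgebra.ι K k) + DJac K _ D a' b (FreeAlgebra.ι K k) := by
      simp only [DJac, add_tmul, map_add, dLadd]; abel
    rw [h1, h, h']
    simp only [add_tmul, map_add, mul_add, add_mul]
    abel
  | hs r a h =>
    obtain ⟨U, h⟩ := h
    refine ⟨r • U, ?_⟩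
    have h1 : DJac K _ D (r • a) b (FreeAlgebra.ι K k) =
        r • DJac K _ D a b (FreeAlgebra.ι K k) := by
      simp only [DJac, ← smul_tmul', map_smul, dLsmul, smul_sub]
    rw [h1, h]
    simp only [← smul_tmul', map_smul, mul_smul_comm, smul_mul_assoc, smul_add, smul_sub, smul_neg]
  | hm a a' h h' =>
    obtain ⟨U, h⟩ := h
    obtain ⟨V, h'⟩ := h'
    refine ⟨e2 K a * V + U * e1 K a' - e23 (g a) * e13 (D (a' ⊗ₜ FreeAlgebra.ι K k)), ?_⟩
    rw [DJac_mul_left hL, h, h', SS_eq_SR hD.1 hv hg, SR, hL.2]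
    generalize D (a ⊗ₜ FreeAlgebra.ι K k) = w
    generalize D (a' ⊗ₜ FreeAlgebra.ι K k) = w'
    generalize g a = x
    generalize flipT K _ (g b) = y
    simp only [map_add, map_sub, map_mul, e23_l, e23_r, e13_l, e13_r]
    simp only [mul_add, add_mul, mul_sub, sub_mul, mul_assoc, T_neg_mul, T_mul_neg, e2_e13, e1_e2]
    have q1 : ∀ t, e2 K a * (e3 K b * t) = e3 K b * (e2 K a * t) := by
      intro t; rw [← mul_assoc, e2_e3, mul_assoc]
    simp only [q1]
    abel

end Free

end MixedDouble


theorem stmt5 {K : Type*} [Field K] [IsAlgClosed K] [CharZero K]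
    {d : ℕ} (hd : 1 ≤ d) (lam : Fin d → K)
    (D : FreeAlgebra K (Fin d) ⊗[K] FreeAlgebra K (Fin d) →ₗ[K] FreeAlgebra K (Fin d) ⊗[K] FreeAlgebra K (Fin d))
    (hD : IsMixedDoublePoisson K (FreeAlgebra K (Fin d)) (FreeAlgebra.ι K) lam D) :
    ∀ a b c : FreeAlgebra K (Fin d),
      br K (FreeAlgebra K (Fin d)) D a (br K (FreeAlgebra K (Fin d)) D b c)
        - br K (FreeAlgebra K (Fin d)) D b (br K (FreeAlgebra K (Fin d)) D a c)
        - br K (FreeAlgebra K (Fin d)) D (br K (FreeAlgebra K (Fin d)) D a b) c = 0 := by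
  intro a b c
  have hL := hD.1.1
  obtain ⟨g, hv, hg⟩ := MixedDouble.exists_g (K := K) (fun i : Fin d =>
    (lam i / 2) • (FreeAlgebra.ι K i ⊗ₜ[K] 1 + 1 ⊗ₜ[K] FreeAlgebra.ι K i))
  induction c using MixedDouble.free_ind with
  | h1 => simp only [MixedDouble.br_one_right hL, MixedDouble.br_zero_right, sub_zero]
  | hv k =>
    exact MixedDouble.jac_zero hL g a b _ (MixedDouble.SS_eq_SR hD.1 hv hg b a)
      (MixedDouble.DJac_gen_left hD hv hg k a b) (MixedDouble.DJac_gen_left hD hv hg k b a)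
  | hm x y h h' =>
    simp only [MixedDouble.br_mul_right hL, MixedDouble.br_add_right]
    rw [sub_sub, sub_eq_zero] at h h'
    rw [h, h']
    noncomm_ring
  | ha x y h h' =>
    simp only [MixedDouble.br_add_right]
    rw [sub_sub, sub_eq_zero] at h h'
    rw [h, h']
    abel
  | hs r x h =>
    simp only [MixedDouble.br_smul_right, ← smul_sub, h, smul_zero]
end
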